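/- arXiv:0704.3469 — 3 statements merged into one kernel-verified Lean document; each statement's English description precedes it below -/
import Mathlib

section
/- The number of permutations of {1,...,n+1} avoiding both the patterns 321 and 3412 satisfies the generating function identity ∑_{n≥0} a_n x^n = (1−x)/(1−3x+x^2), equivalently a_0 = 1, a_1 = 2, and a_n = 3a_{n−1} − a_{n−2} for n ≥ 2. -/
/-- `w` contains `p` as a (classical, 1-line) permutation pattern. -/
def ContainsPattern {n k : ℕ} (w : Equiv.Perm (Fin n)) (p : Equiv.Perm (Fin k)) : Prop :=
  ∃ f : Fin k ↪o Fin n, ∀ a b : Fin k, p a < p b ↔ w (f a) < w (f b)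

/-- `w` avoids the pattern `p`. -/
def AvoidsPattern {n k : ℕ} (w : Equiv.Perm (Fin n)) (p : Equiv.Perm (Fin k)) : Prop :=
  ¬ ContainsPattern w p

noncomputable def p321 : Equiv.Perm (Fin 3) := Equiv.ofBijective ![2,1,0] (by decide)
noncomputable def p3412 : Equiv.Perm (Fin 4) := Equiv.ofBijective ![2,3,0,1] (by decide)
noncomputable def p3421 : Equiv.Perm (Fin 4) := Equiv.ofBijective ![2,3,1,0] (by decide)
noncomputable def p4312 : Equiv.Perm (Fin 4) := Equiv.ofBijective ![3,2,0,1] (by decide)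
noncomputable def p4321 : Equiv.Perm (Fin 4) := Equiv.ofBijective ![3,2,1,0] (by decide)
noncomputable def p4231 : Equiv.Perm (Fin 4) := Equiv.ofBijective ![3,1,2,0] (by decide)
noncomputable def p356124 : Equiv.Perm (Fin 6) := Equiv.ofBijective ![2,4,5,0,1,3] (by decide)
noncomputable def p456123 : Equiv.Perm (Fin 6) := Equiv.ofBijective ![3,4,5,0,1,2] (by decide)
noncomputable def p46718235 : Equiv.Perm (Fin 8) := Equiv.ofBijective ![3,5,6,0,7,1,2,4] (by decide)
noncomputable def p46781235 : Equiv.Perm (Fin 8) := Equiv.ofBijective ![3,5,6,7,0,1,2,4] (by decide)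
noncomputable def p56718234 : Equiv.Perm (Fin 8) := Equiv.ofBijective ![4,5,6,0,7,1,2,3] (by decide)
noncomputable def p56781234 : Equiv.Perm (Fin 8) := Equiv.ofBijective ![4,5,6,7,0,1,2,3] (by decide)

/-- `w` has neither a decreasing subsequence of length three nor a subsequence ordered
like `3412`. -/
def AvoidsBoth {n : ℕ} (w : Equiv.Perm (Fin n)) : Prop :=
  (∀ i j k, i < j → j < k → w k < w j → w j < w i → False) ∧
  ∀ i j k l, i < j → j < k → k < l → w k < w l → w l < w i → w i < w j → False

theorem containsPattern_p321_iff {n : ℕ} (w : Equiv.Perm (Fin n)) :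
    ContainsPattern w p321 ↔ ∃ i j k, i < j ∧ j < k ∧ w k < w j ∧ w j < w i := by
  constructor
  · rintro ⟨f, hf⟩
    exact ⟨f 0, f 1, f 2, f.strictMono (by decide), f.strictMono (by decide),
      (hf 2 1).1 (by simp [p321]), (hf 1 0).1 (by simp [p321])⟩
  · rintro ⟨i, j, k, hij, hjk, h1, h2⟩
    have hmono : StrictMono ![i, j, k] := by
      intro a b
      fin_cases a <;> fin_cases b <;> simp <;> omega
    refine ⟨OrderEmbedding.ofStrictMono _ hmono, fun a b ↦ ?_⟩
    rw [OrderEmbedding.coe_ofStrictMono]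
    fin_cases a <;> fin_cases b <;> simp [p321] <;> omega

theorem containsPattern_p3412_iff {n : ℕ} (w : Equiv.Perm (Fin n)) :
    ContainsPattern w p3412 ↔
      ∃ i j k l, i < j ∧ j < k ∧ k < l ∧ w k < w l ∧ w l < w i ∧ w i < w j := by
  constructor
  · rintro ⟨f, hf⟩
    exact ⟨f 0, f 1, f 2, f 3, f.strictMono (by decide), f.strictMono (by decide),
      f.strictMono (by decide), (hf 2 3).1 (by simp [p3412]),
      (hf 3 0).1 (by simp [p3412]), (hf 0 1).1 (by simp [p3412])⟩
  · rintro ⟨i, j, k, l, hij, hjk, hkl, h1, h2, h3⟩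
    have hmono : StrictMono ![i, j, k, l] := by
      intro a b
      fin_cases a <;> fin_cases b <;> simp <;> omega
    refine ⟨OrderEmbedding.ofStrictMono _ hmono, fun a b ↦ ?_⟩
    rw [OrderEmbedding.coe_ofStrictMono]
    fin_cases a <;> fin_cases b <;> simp [p3412] <;> omega

theorem avoidsPattern_and_iff {n : ℕ} (w : Equiv.Perm (Fin n)) :
    AvoidsPattern w p321 ∧ AvoidsPattern w p3412 ↔ AvoidsBoth w := by
  simp only [AvoidsPattern, containsPattern_p321_iff, containsPattern_p3412_iff, AvoidsBoth,
    not_exists, not_and, imp_false]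

theorem AvoidsBoth.inv {n : ℕ} {w : Equiv.Perm (Fin n)} (hw : AvoidsBoth w) :
    AvoidsBoth w⁻¹ :=
  ⟨fun i j k hij hjk h1 h2 ↦ hw.1 _ _ _ h1 h2 (by simpa) (by simpa),
    fun i j k l hij hjk hkl h1 h2 h3 ↦
      hw.2 _ _ _ _ h1 h2 h3 (by simpa) (by simpa) (by simpa)⟩

theorem avoidsBoth_iff_of_apply_zero_le_one {n : ℕ} {w : Equiv.Perm (Fin (n + 1))}
    {e : Equiv.Perm (Fin n)} (h0 : (w 0).val ≤ 1)
    (h : ∀ i j, w i.succ < w j.succ ↔ e i < e j) : AvoidsBoth w ↔ AvoidsBoth e := by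
  refine ⟨fun hw ↦ ⟨fun i j k hij hjk h1 h2 ↦ ?_, fun i j k l hij hjk hkl h1 h2 h3 ↦ ?_⟩,
    fun he ↦ ⟨fun i j k hij hjk h1 h2 ↦ ?_, fun i j k l hij hjk hkl h1 h2 h3 ↦ ?_⟩⟩
  · exact hw.1 i.succ j.succ k.succ (by simpa) (by simpa) (by simpa [h]) (by simpa [h])
  · exact hw.2 i.succ j.succ k.succ l.succ (by simpa) (by simpa) (by simpa) (by simpa [h])
      (by simpa [h]) (by simpa [h])
  · cases i using Fin.cases with
    | zero => omega
    | succ i =>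
      obtain ⟨j, rfl⟩ := Fin.exists_succ_eq.2 (Fin.ne_zero_of_lt hij)
      obtain ⟨k, rfl⟩ := Fin.exists_succ_eq.2 (Fin.ne_zero_of_lt hjk)
      simp only [h, Fin.succ_lt_succ_iff] at *
      exact he.1 i j k hij hjk h1 h2
  · cases i using Fin.cases with
    | zero => omega
    | succ i =>
      obtain ⟨j, rfl⟩ := Fin.exists_succ_eq.2 (Fin.ne_zero_of_lt hij)
      obtain ⟨k, rfl⟩ := Fin.exists_succ_eq.2 (Fin.ne_zero_of_lt hjk)
      obtain ⟨l, rfl⟩ := Fin.exists_succ_eq.2 (Fin.ne_zero_of_lt hkl)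
      simp only [h, Fin.succ_lt_succ_iff] at *
      exact he.2 i j k l hij hjk hkl h1 h2 h3

theorem decomposeFin_symm_succ_lt_iff {n : ℕ} {c : Fin (n + 1)} (hc : c.val ≤ 1)
    (e : Equiv.Perm (Fin n)) (i j : Fin n) :
    Equiv.Perm.decomposeFin.symm (c, e) i.succ < Equiv.Perm.decomposeFin.symm (c, e) j.succ ↔
      e i < e j := by
  simp only [Equiv.Perm.decomposeFin_symm_apply_succ, Equiv.swap_apply_def, Fin.succ_ne_zero,
    if_false]
  split_ifs <;> simp only [Fin.ext_iff, Fin.lt_def, Fin.val_succ, Fin.val_zero] at * <;> omega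

theorem avoidsBoth_decomposeFin_symm {n : ℕ} {c : Fin (n + 1)} (hc : c.val ≤ 1)
    (e : Equiv.Perm (Fin n)) :
    AvoidsBoth (Equiv.Perm.decomposeFin.symm (c, e)) ↔ AvoidsBoth e :=
  avoidsBoth_iff_of_apply_zero_le_one (by simpa) (decomposeFin_symm_succ_lt_iff hc e)

theorem AvoidsBoth.apply_zero {n : ℕ} {w : Equiv.Perm (Fin (n + 2))} (hw : AvoidsBoth w) :
    w 0 = 0 ∨ w 0 = 1 ∨ w 1 = 0 := by
  by_contra! hne
  obtain ⟨h0, h1, h2⟩ := hne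
  obtain ⟨j, hj⟩ := w.surjective 0
  obtain ⟨k, hk⟩ := w.surjective 1
  have hj0 : j ≠ 0 := by rintro rfl; exact h0 hj
  have hj1 : j ≠ 1 := by rintro rfl; exact h2 hj
  have hk0 : k ≠ 0 := by rintro rfl; exact h1 hk
  have hjk : j ≠ k := by rintro rfl; simp [hj] at hk
  have hw1 : w 1 ≠ w 0 := by simp
  have hkpos : 0 < k := Fin.pos_iff_ne_zero.2 hk0
  have hjv := congrArg Fin.val hj
  have hkv := congrArg Fin.val hk
  simp only [ne_eq, Fin.ext_iff, Fin.val_zero, Fin.val_one] at *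
  rcases lt_or_gt_of_ne hjk with hlt | hlt
  · rcases lt_or_gt_of_ne hw1 with hlt' | hlt'
    · exact hw.1 0 1 j (Fin.lt_def.2 (by simp)) (Fin.lt_def.2 (by simp; omega))
        (Fin.lt_def.2 (by omega)) (Fin.lt_def.2 hlt')
    · exact hw.2 0 1 j k (Fin.lt_def.2 (by simp)) (Fin.lt_def.2 (by simp; omega))
        (Fin.lt_def.2 hlt) (Fin.lt_def.2 (by omega)) (Fin.lt_def.2 (by omega))
        (Fin.lt_def.2 hlt')
  · exact hw.1 0 k j hkpos (Fin.lt_def.2 hlt)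
      (Fin.lt_def.2 (by omega)) (Fin.lt_def.2 (by omega))

open Classical in
/-- The permutations of `Fin n` avoiding both `321` and `3412`. -/
noncomputable def avoiders (n : ℕ) : Finset (Equiv.Perm (Fin n)) :=
  Finset.univ.filter AvoidsBoth

theorem mem_avoiders {n : ℕ} {w : Equiv.Perm (Fin n)} : w ∈ avoiders n ↔ AvoidsBoth w := by
  simp [avoiders]

theorem card_avoiders_of_le_two {n : ℕ} (hn : n ≤ 2) : (avoiders n).card = n.factorial := by
  have : avoiders n = Finset.univ := by
    ext w
    simp only [mem_avoiders, Finset.mem_univ, iff_true]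
    exact ⟨fun i j k _ _ ↦ by omega, fun i j k l _ _ ↦ by omega⟩
  rw [this, Finset.card_univ, Fintype.card_perm, Fintype.card_fin]

theorem card_avoiders_filter_apply_zero {n : ℕ} {c : Fin (n + 1)} (hc : c.val ≤ 1) :
    ((avoiders (n + 1)).filter fun w ↦ w 0 = c).card = (avoiders n).card := by
  symm
  refine Finset.card_bij (fun e _ ↦ Equiv.Perm.decomposeFin.symm (c, e)) ?_ ?_ ?_
  · intro e he
    simpa [mem_avoiders, avoidsBoth_decomposeFin_symm hc] using he
  · intro e _ e' _ h
    simpa using h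
  · intro w hw
    obtain ⟨⟨d, e⟩, rfl⟩ := Equiv.Perm.decomposeFin.symm.surjective w
    simp only [Finset.mem_filter, mem_avoiders, Equiv.Perm.decomposeFin_symm_apply_zero] at hw
    obtain ⟨hw, rfl⟩ := hw
    exact ⟨e, mem_avoiders.2 ((avoidsBoth_decomposeFin_symm hc e).1 hw), rfl⟩

theorem card_avoiders_filter_apply_one (n : ℕ) :
    ((avoiders (n + 2)).filter fun w ↦ w 1 = 0).card = (avoiders (n + 1)).card := by
  rw [← card_avoiders_filter_apply_zero (c := 1) (by simp)]
  refine Finset.card_nbij' (·⁻¹) (·⁻¹) ?_ ?_ (fun w _ ↦ inv_inv w) (fun w _ ↦ inv_inv w)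
  · intro w hw
    simp only [Finset.coe_filter, Set.mem_ofPred_eq, mem_avoiders] at hw ⊢
    exact ⟨hw.1.inv, Equiv.Perm.inv_eq_iff_eq.2 hw.2.symm⟩
  · intro w hw
    simp only [Finset.coe_filter, Set.mem_ofPred_eq, mem_avoiders] at hw ⊢
    exact ⟨hw.1.inv, Equiv.Perm.inv_eq_iff_eq.2 hw.2.symm⟩

theorem card_avoiders_filter_swap (n : ℕ) :
    ((avoiders (n + 2)).filter fun w ↦ w 0 = 1 ∧ w 1 = 0).card = (avoiders n).card := by
  rw [← card_avoiders_filter_apply_zero (c := 0) (by simp)]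
  symm
  refine Finset.card_bij (fun e _ ↦ Equiv.Perm.decomposeFin.symm (1, e)) ?_ ?_ ?_
  · intro e he
    simp only [Finset.mem_filter, mem_avoiders] at he ⊢
    refine ⟨(avoidsBoth_decomposeFin_symm (by simp) e).2 he.1, by simp, ?_⟩
    rw [← Fin.succ_zero_eq_one, Equiv.Perm.decomposeFin_symm_apply_succ, he.2]
    simp
  · intro e _ e' _ h
    simpa using h
  · intro w hw
    obtain ⟨⟨d, e⟩, rfl⟩ := Equiv.Perm.decomposeFin.symm.surjective w
    simp only [Finset.mem_filter, mem_avoiders, Equiv.Perm.decomposeFin_symm_apply_zero] at hw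
    obtain ⟨hw, rfl, h⟩ := hw
    refine ⟨e, Finset.mem_filter.2
      ⟨mem_avoiders.2 ((avoidsBoth_decomposeFin_symm (by simp) e).1 hw), ?_⟩, rfl⟩
    rw [← Fin.succ_zero_eq_one, Equiv.Perm.decomposeFin_symm_apply_succ,
      Equiv.swap_apply_eq_iff, Equiv.swap_apply_left] at h
    exact Fin.succ_injective _ h

theorem card_avoiders_add_two (n : ℕ) :
    (avoiders (n + 2)).card + (avoiders n).card = 3 * (avoiders (n + 1)).card := by
  have hunion : avoiders (n + 2) = (avoiders (n + 2)).filter (fun w ↦ w 0 = 0) ∪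
      ((avoiders (n + 2)).filter (fun w ↦ w 0 = 1) ∪
        (avoiders (n + 2)).filter (fun w ↦ w 1 = 0)) := by
    rw [← Finset.filter_or, ← Finset.filter_or, Finset.filter_true_of_mem]
    exact fun w hw ↦ (mem_avoiders.1 hw).apply_zero
  have hdisj : Disjoint ((avoiders (n + 2)).filter (fun w ↦ w 0 = 0))
      ((avoiders (n + 2)).filter (fun w ↦ w 0 = 1) ∪
        (avoiders (n + 2)).filter (fun w ↦ w 1 = 0)) := by
    rw [← Finset.filter_or, Finset.disjoint_filter]
    rintro w - h0 (h1 | h1)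
    · simp [h0] at h1
    · simpa using w.injective (h0.trans h1.symm)
  have hinter := Finset.card_union_add_card_inter
    ((avoiders (n + 2)).filter (fun w ↦ w 0 = 1)) ((avoiders (n + 2)).filter (fun w ↦ w 1 = 0))
  rw [← Finset.filter_and, card_avoiders_filter_swap, card_avoiders_filter_apply_one,
    card_avoiders_filter_apply_zero (by simp)] at hinter
  rw [hunion, Finset.card_union_of_disjoint hdisj, card_avoiders_filter_apply_zero (by simp)]
  omega

theorem natCard_avoidsPattern (n : ℕ) :
    Nat.card {w : Equiv.Perm (Fin n) // AvoidsPattern w p321 ∧ AvoidsPattern w p3412} =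
      (avoiders n).card := by
  simp only [avoidsPattern_and_iff, ← mem_avoiders]
  exact Nat.subtype_card _ fun _ ↦ Iff.rfl

open PowerSeries in
theorem mk_mul_eq_one_sub_X {a : ℕ → ℕ} (h0 : a 0 = 1) (h1 : a 1 = 2)
    (h : ∀ n, a (n + 2) + a n = 3 * a (n + 1)) :
    (PowerSeries.mk fun n => (a n : ℚ)) * (1 - 3 * X + X ^ 2) = 1 - X := by
  have key : (PowerSeries.mk fun n => (a n : ℚ)) * (1 - 3 * X + X ^ 2) =
      (PowerSeries.mk fun n => (a n : ℚ)) - C 3 * ((PowerSeries.mk fun n => (a n : ℚ)) * X) +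
        (PowerSeries.mk fun n => (a n : ℚ)) * X * X := by
    rw [map_ofNat]
    ring
  rw [key]
  ext n
  match n with
  | 0 => simp [h0]
  | 1 => simp [coeff_succ_mul_X, coeff_C_mul, coeff_one, coeff_X, h0, h1]; norm_num
  | n + 2 =>
    have hn : (a (n + 2) : ℚ) + a n = 3 * a (n + 1) := mod_cast h n
    simp [coeff_succ_mul_X, coeff_C_mul, coeff_one, coeff_X]
    linarith

open PowerSeries in
/-- The number `a n` of permutations of `{1,…,n+1}` avoiding 321 and 3412 has generating
function `(1-x)/(1-3x+x²)`; equivalently `a 0 = 1`, `a 1 = 2`, and `a (n+2) = 3 a (n+1) - a n`. -/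
theorem stmt_2
    (a : ℕ → ℕ)
    (ha : ∀ n, a n = Nat.card {w : Equiv.Perm (Fin (n + 1)) //
      AvoidsPattern w p321 ∧ AvoidsPattern w p3412}) :
    (PowerSeries.mk fun n => (a n : ℚ)) * (1 - 3 * X + X ^ 2) = 1 - X ∧
    a 0 = 1 ∧ a 1 = 2 ∧ ∀ n, a (n + 2) + a n = 3 * a (n + 1) := by
  have h0 : a 0 = 1 := by
    rw [ha, natCard_avoidsPattern, card_avoiders_of_le_two (by simp), zero_add, Nat.factorial_one]
  have h1 : a 1 = 2 := by
    rw [ha, natCard_avoidsPattern, card_avoiders_of_le_two le_rfl, Nat.factorial_two]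
  have h : ∀ n, a (n + 2) + a n = 3 * a (n + 1) := fun n ↦ by
    simpa only [ha, natCard_avoidsPattern] using card_avoiders_add_two (n + 1)
  exact ⟨mk_mul_eq_one_sub_X h0 h1 h, h0, h1, h⟩
end

section
/- The number c_n of permutations of {1,...,n} avoiding the five patterns 321, 46718235, 46781235, 56718234, 56781234 (the 321-hexagon-avoiding permutations) satisfies the recurrence c_{n+1} = 6c_n − 11c_{n−1} + 9c_{n−2} − 4c_{n−3} − 4c_{n−4} + c_{n−5} for all n ≥ 8, with initial values c_3 = 5, c_4 = 14, c_5 = 42, c_6 = 132, c_7 = 429, c_8 = 1426, c_9 = 4806. -/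
/-- States of the automaton recognising step words. A state records the current height; at height
two also whether the last step descended from height three, and at height three also the last
step. -/
inductive HeightState
  | zero | one | two | twoFallen | threeRisen | threeUpper | threeLower | dead
  deriving DecidableEq

namespace HeightState

instance : Fintype HeightState where
  elems := {zero, one, two, twoFallen, threeRisen, threeUpper, threeLower, dead}
  complete s := by cases s <;> simp

/-- Transition function. The first component of a letter says that the position is an excedance,
the second that the value is an excedance value. -/
def next : HeightState → Bool × Bool → HeightState
  | zero, (true, false) => one
  | zero, (false, false) => zero
  | one, (true, false) => two
  | one, (false, true) => zero
  | one, _ => one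
  | two, (true, false) => threeRisen
  | two, (false, true) => one
  | two, _ => two
  | twoFallen, (false, true) => one
  | twoFallen, (true, true) => two
  | twoFallen, (false, false) => two
  | threeRisen, (false, true) => twoFallen
  | threeRisen, (true, true) => threeUpper
  | threeRisen, (false, false) => threeLower
  | threeUpper, (false, true) => twoFallen
  | threeUpper, (true, true) => threeUpper
  | threeLower, (false, true) => twoFallen
  | threeLower, (false, false) => threeLower
  | _, _ => dead

/-- The state reached after the first `n` letters of `x`. -/
def run (x : ℕ → Bool × Bool) : ℕ → HeightState
  | 0 => zero
  | n + 1 => next (run x n) (x n)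

end HeightState

/-- Extend a finite word by the letter `(false, false)`. -/
def extendWord {n : ℕ} (x : Fin n → Bool × Bool) (i : ℕ) : Bool × Bool :=
  if h : i < n then x ⟨i, h⟩ else (false, false)

lemma run_congr {x y : ℕ → Bool × Bool} {n : ℕ} (h : ∀ i < n, x i = y i) :
    HeightState.run x n = HeightState.run y n := by
  induction n with
  | zero => rfl
  | succ n ih => rw [HeightState.run, HeightState.run, h n n.lt_succ_self,
      ih fun i hi => h i (hi.trans n.lt_succ_self)]

/-- The number of words of length `n` leading to the state `s`. -/
def wordCount (n : ℕ) (s : HeightState) : ℕ :=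
  Fintype.card {x : Fin n → Bool × Bool // HeightState.run (extendWord x) n = s}

lemma wordCount_eq_sum (n : ℕ) (s : HeightState) :
    wordCount n s =
      ∑ x : Fin n → Bool × Bool, if HeightState.run (extendWord x) n = s then 1 else 0 := by
  rw [wordCount, Fintype.card_subtype, Finset.card_filter]

lemma run_extendWord_snoc {n : ℕ} (x : Fin n → Bool × Bool) (l : Bool × Bool) :
    HeightState.run (extendWord (Fin.snoc x l : Fin (n + 1) → Bool × Bool)) (n + 1) =
      HeightState.next (HeightState.run (extendWord x) n) l := by
  have h₁ : extendWord (Fin.snoc x l : Fin (n + 1) → Bool × Bool) n = l := by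
    simp [extendWord, Fin.snoc]
  have h₂ : ∀ i < n, extendWord (Fin.snoc x l : Fin (n + 1) → Bool × Bool) i =
      extendWord x i := fun i hi => by
    simp [extendWord, Fin.snoc, hi, hi.trans n.lt_succ_self]
  rw [HeightState.run, h₁, run_congr h₂]

lemma wordCount_succ (n : ℕ) (s : HeightState) :
    wordCount (n + 1) s =
      ∑ t, (∑ l : Bool × Bool, if t.next l = s then 1 else 0) * wordCount n t := by
  simp only [wordCount_eq_sum, Finset.mul_sum]
  rw [Finset.sum_comm, ← (Fin.snocEquiv fun _ => Bool × Bool).sum_comp,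
    Fintype.sum_prod_type_right]
  refine Finset.sum_congr rfl fun x _ => ?_
  simp only [mul_ite, mul_one, mul_zero, Finset.sum_ite_eq, Finset.mem_univ, if_true]
  refine Finset.sum_congr rfl fun l _ => ?_
  rw [← run_extendWord_snoc]
  rfl

lemma wordCount_step (n : ℕ) :
    wordCount (n + 1) .zero = wordCount n .zero + wordCount n .one ∧
    wordCount (n + 1) .one = wordCount n .zero + 2 * wordCount n .one + wordCount n .two +
      wordCount n .twoFallen ∧
    wordCount (n + 1) .two = wordCount n .one + 2 * wordCount n .two +
      2 * wordCount n .twoFallen ∧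
    wordCount (n + 1) .twoFallen = wordCount n .threeRisen + wordCount n .threeUpper +
      wordCount n .threeLower ∧
    wordCount (n + 1) .threeRisen = wordCount n .two ∧
    wordCount (n + 1) .threeUpper = wordCount n .threeRisen + wordCount n .threeUpper ∧
    wordCount (n + 1) .threeLower = wordCount n .threeRisen + wordCount n .threeLower := by
  have huniv : (Finset.univ : Finset HeightState) = {.zero, .one, .two, .twoFallen, .threeRisen,
    .threeUpper, .threeLower, .dead} := rfl
  simp only [wordCount_succ, huniv, Fintype.sum_prod_type, Fintype.sum_bool]
  simp [HeightState.next]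
  omega

lemma wordCount_zero (s : HeightState) :
    wordCount 0 s = if HeightState.zero = s then 1 else 0 := by
  simp [wordCount_eq_sum, HeightState.run]
  rfl

lemma wordCount_recurrence (n : ℕ) :
    (wordCount (n + 6) .zero : ℤ) = 6 * wordCount (n + 5) .zero - 11 * wordCount (n + 4) .zero +
      9 * wordCount (n + 3) .zero - 4 * wordCount (n + 2) .zero - 4 * wordCount (n + 1) .zero +
      wordCount n .zero := by
  have h₀ := wordCount_step n
  have h₁ := wordCount_step (n + 1)
  have h₂ := wordCount_step (n + 2)
  have h₃ := wordCount_step (n + 3)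
  have h₄ := wordCount_step (n + 4)
  have h₅ := wordCount_step (n + 5)
  simp only [add_assoc, Nat.reduceAdd] at h₁ h₂ h₃ h₄ h₅
  simp only [h₀, h₁, h₂, h₃, h₄, h₅]
  push_cast
  ring

lemma wordCount_initial :
    wordCount 3 .zero = 5 ∧ wordCount 4 .zero = 14 ∧ wordCount 5 .zero = 42 ∧
    wordCount 6 .zero = 132 ∧ wordCount 7 .zero = 429 ∧ wordCount 8 .zero = 1426 ∧
    wordCount 9 .zero = 4806 := by
  have h₁ := wordCount_step 0
  simp [wordCount_zero] at h₁
  have h₂ := wordCount_step 1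
  simp [h₁] at h₂
  have h₃ := wordCount_step 2
  simp [h₂] at h₃
  have h₄ := wordCount_step 3
  simp [h₃] at h₄
  have h₅ := wordCount_step 4
  simp [h₄] at h₅
  have h₆ := wordCount_step 5
  simp [h₅] at h₆
  have h₇ := wordCount_step 6
  simp [h₆] at h₇
  have h₈ := wordCount_step 7
  simp [h₇] at h₈
  have h₉ := wordCount_step 8
  simp [h₈] at h₉
  exact ⟨h₃.1, h₄.1, h₅.1, h₆.1, h₇.1, h₈.1, h₉.1⟩

/-- The number of the first `j` letters of `x` whose first component is true. -/
def upperCount (x : ℕ → Bool × Bool) (j : ℕ) : ℕ := Nat.count (fun i => (x i).1) j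

/-- The number of the first `j` letters of `x` whose second component is true. -/
def lowerCount (x : ℕ → Bool × Bool) (j : ℕ) : ℕ := Nat.count (fun i => (x i).2) j

/-- The first `n` letters of `x` describe a path of height at most three, not returning to height
three in two steps exactly one of which has a true first component. -/
def Admissible (x : ℕ → Bool × Bool) (n : ℕ) : Prop :=
  (∀ j < n, lowerCount x (j + 1) ≤ upperCount x j) ∧
  (∀ j ≤ n, upperCount x j ≤ lowerCount x j + 3) ∧
  ∀ m, m + 2 ≤ n → ¬(upperCount x m = lowerCount x m + 3 ∧
    upperCount x (m + 2) = lowerCount x (m + 2) + 3 ∧ upperCount x (m + 2) = upperCount x m + 1)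

lemma upperCount_succ (x : ℕ → Bool × Bool) (j : ℕ) :
    upperCount x (j + 1) = upperCount x j + if (x j).1 then 1 else 0 :=
  Nat.count_succ _ _

lemma lowerCount_succ (x : ℕ → Bool × Bool) (j : ℕ) :
    lowerCount x (j + 1) = lowerCount x j + if (x j).2 then 1 else 0 :=
  Nat.count_succ _ _

lemma admissible_succ (x : ℕ → Bool × Bool) (n : ℕ) :
    Admissible x (n + 1) ↔ Admissible x n ∧ lowerCount x (n + 1) ≤ upperCount x n ∧
      upperCount x (n + 1) ≤ lowerCount x (n + 1) + 3 ∧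
      ∀ k, n = k + 1 → ¬(upperCount x k = lowerCount x k + 3 ∧
        upperCount x (n + 1) = lowerCount x (n + 1) + 3 ∧
        upperCount x (n + 1) = upperCount x k + 1) := by
  constructor
  · rintro ⟨h₁, h₂, h₃⟩
    refine ⟨⟨fun j hj => h₁ j (by omega), fun j hj => h₂ j (by omega),
      fun m hm => h₃ m (by omega)⟩, h₁ n (by omega), h₂ _ le_rfl, ?_⟩
    rintro k rfl
    exact h₃ k le_rfl
  · rintro ⟨⟨h₁, h₂, h₃⟩, h₄, h₅, h₆⟩
    refine ⟨fun j hj => ?_, fun j hj => ?_, fun m hm => ?_⟩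
    · obtain rfl | hj := Nat.lt_succ_iff_lt_or_eq.1 hj |>.symm
      exacts [h₄, h₁ j hj]
    · obtain rfl | hj := hj.eq_or_lt
      exacts [h₅, h₂ j (by omega)]
    · obtain hm | hm := hm.eq_or_lt
      · obtain rfl : n = m + 1 := by omega
        exact h₆ m rfl
      · exact h₃ m (by omega)

/-- What a state says about the counts of the word read so far. -/
def HeightState.Describes (x : ℕ → Bool × Bool) (n : ℕ) : HeightState → Prop
  | zero => upperCount x n = lowerCount x n
  | one => upperCount x n = lowerCount x n + 1
  | two => upperCount x n = lowerCount x n + 2 ∧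
      ∀ k, n = k + 1 → upperCount x k ≠ lowerCount x k + 3
  | twoFallen => upperCount x n = lowerCount x n + 2 ∧
      ∃ k, n = k + 1 ∧ upperCount x k = lowerCount x k + 3 ∧ upperCount x n = upperCount x k
  | threeRisen => upperCount x n = lowerCount x n + 3 ∧
      ∀ k, n = k + 1 → upperCount x k ≠ lowerCount x k + 3
  | threeUpper => upperCount x n = lowerCount x n + 3 ∧
      ∃ k, n = k + 1 ∧ upperCount x k = lowerCount x k + 3 ∧ upperCount x n = upperCount x k + 1
  | threeLower => upperCount x n = lowerCount x n + 3 ∧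
      ∃ k, n = k + 1 ∧ upperCount x k = lowerCount x k + 3 ∧ upperCount x n = upperCount x k
  | dead => False

lemma run_spec (x : ℕ → Bool × Bool) (n : ℕ) :
    Admissible x n ∧ (HeightState.run x n).Describes x n ∨
      ¬ Admissible x n ∧ HeightState.run x n = .dead := by
  induction n with
  | zero => simp [Admissible, HeightState.run, HeightState.Describes, upperCount, lowerCount]
  | succ n ih =>
    rw [HeightState.run, admissible_succ]
    obtain ⟨ha, hd⟩ | ⟨ha, hd⟩ := ih
    · have hu := upperCount_succ x n
      have hl := lowerCount_succ x n
      generalize x n = l at hu hl ⊢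
      obtain ⟨e, f⟩ := l
      cases hs : HeightState.run x n <;> rw [hs] at hd <;> simp only [HeightState.Describes] at hd <;>
        cases e <;> cases f <;> simp only [HeightState.next, HeightState.Describes] <;> grind
    · exact .inr ⟨fun h => ha h.1, by rw [hd]; rfl⟩

lemma run_eq_zero_iff (x : ℕ → Bool × Bool) (n : ℕ) :
    HeightState.run x n = .zero ↔ Admissible x n ∧ upperCount x n = lowerCount x n := by
  obtain ⟨ha, hd⟩ | ⟨ha, hd⟩ := run_spec x n
  · cases hs : HeightState.run x n <;> rw [hs] at hd <;>
      simp only [HeightState.Describes] at hd <;> grind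
  · simp [ha, hd]

lemma upperCount_add_le (x : ℕ → Bool × Bool) {i j : ℕ} (h : i ≤ j) :
    upperCount x i ≤ upperCount x j ∧ upperCount x j + i ≤ upperCount x i + j := by
  induction j, h using Nat.le_induction with
  | base => simp
  | succ j h ih => have := upperCount_succ x j; split_ifs at this <;> omega

lemma lowerCount_add_le (x : ℕ → Bool × Bool) {i j : ℕ} (h : i ≤ j) :
    lowerCount x i ≤ lowerCount x j ∧ lowerCount x j + i ≤ lowerCount x i + j := by
  induction j, h using Nat.le_induction with
  | base => simp
  | succ j h ih => have := lowerCount_succ x j; split_ifs at this <;> omega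

lemma upperCount_lt_of_fst {x : ℕ → Bool × Bool} {i j : ℕ} (hi : (x i).1) (hij : i < j) :
    upperCount x i < upperCount x j :=
  Nat.count_strict_mono (p := fun i => (x i).1) hi hij

lemma lowerCount_lt_of_snd {x : ℕ → Bool × Bool} {i j : ℕ} (hi : (x i).2) (hij : i < j) :
    lowerCount x i < lowerCount x j :=
  Nat.count_strict_mono (p := fun i => (x i).2) hi hij

lemma upperCount_add_lt_of_not_fst {x : ℕ → Bool × Bool} {i j : ℕ} (hi : ¬ (x i).1)
    (hij : i < j) : upperCount x j + i < upperCount x i + j := by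
  have h₁ := upperCount_succ x i
  have h₂ := upperCount_add_le x (Nat.succ_le_of_lt hij)
  rw [if_neg hi] at h₁
  simp only [Nat.succ_eq_add_one] at h₂
  omega

lemma lowerCount_add_lt_of_not_snd {x : ℕ → Bool × Bool} {i j : ℕ} (hi : ¬ (x i).2)
    (hij : i < j) : lowerCount x j + i < lowerCount x i + j := by
  have h₁ := lowerCount_succ x i
  have h₂ := lowerCount_add_le x (Nat.succ_le_of_lt hij)
  rw [if_neg hi] at h₁
  simp only [Nat.succ_eq_add_one] at h₂
  omega

lemma exists_count_eq {p : ℕ → Prop} [DecidablePred p] {k n : ℕ} (h : k < Nat.count p n) :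
    ∃ i < n, p i ∧ Nat.count p i = k := by
  induction n with
  | zero => simp at h
  | succ n ih =>
    by_cases hk : k < Nat.count p n
    · obtain ⟨i, hi, hp⟩ := ih hk
      exact ⟨i, by omega, hp⟩
    · rw [Nat.count_succ] at h
      split_ifs at h with hn
      · exact ⟨n, n.lt_succ_self, hn, by omega⟩
      · omega

lemma count_add_count_not (p : ℕ → Prop) [DecidablePred p] (n : ℕ) :
    Nat.count p n + Nat.count (fun i => ¬ p i) n = n := by
  induction n with
  | zero => simp
  | succ n ih => rw [Nat.count_succ, Nat.count_succ]; split_ifs <;> omega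

lemma count_apply_of_increasing (V : Equiv.Perm ℕ) {p q : ℕ → Prop} [DecidablePred p]
    [DecidablePred q] (hpq : ∀ i, q (V i) ↔ p i)
    (hV : ∀ i j, p i → p j → i < j → V i < V j) {i : ℕ} (hi : p i) :
    Nat.count q (V i) = Nat.count p i := by
  rw [Nat.count_eq_card_filter_range, Nat.count_eq_card_filter_range]
  symm
  refine Finset.card_bij (fun j _ => V j) (fun j hj => ?_) (fun _ _ _ _ h => V.injective h)
    fun v hv => ?_
  · simp only [Finset.mem_filter, Finset.mem_range] at hj ⊢
    exact ⟨hV _ _ hj.2 hi hj.1, (hpq j).2 hj.2⟩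
  · simp only [Finset.mem_filter, Finset.mem_range] at hv ⊢
    obtain ⟨j, rfl⟩ := V.surjective v
    have hj := (hpq j).1 hv.2
    refine ⟨j, ⟨?_, hj⟩, rfl⟩
    by_contra! hij
    obtain rfl | hij := hij.eq_or_lt
    · exact lt_irrefl _ hv.1
    · exact lt_asymm hv.1 (hV _ _ hi hj hij)

/-- No three values of `V` are decreasing. -/
def NoDecreasingTriple (V : ℕ → ℕ) : Prop :=
  ∀ i j k, i < j → j < k → V k < V j → ¬ V j < V i

/-- The excedance positions and the excedance values of a permutation of `ℕ`. -/
def stepWord (V : Equiv.Perm ℕ) (i : ℕ) : Bool × Bool :=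
  (decide (i < V i), decide (V.symm i < i))

lemma stepWord_fst (V : Equiv.Perm ℕ) (i : ℕ) : (stepWord V i).1 = true ↔ i < V i := by
  simp [stepWord]

lemma stepWord_snd (V : Equiv.Perm ℕ) (i : ℕ) : (stepWord V (V i)).2 = true ↔ i < V i := by
  simp [stepWord]

section

variable {V : Equiv.Perm ℕ}

lemma exists_gt_of_inversion {i j : ℕ} (hij : i < j) (hj : j ≤ V j) (hV : V j < V i) :
    ∃ k, j < k ∧ V k < V j := by
  by_contra! h
  have hsub : Finset.range (V j + 1) ⊆ ((Finset.range (j + 1)).erase i).image V := by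
    intro v hv
    obtain ⟨k, rfl⟩ := V.surjective v
    simp only [Finset.mem_range, Finset.mem_image, Finset.mem_erase] at hv ⊢
    refine ⟨k, ⟨by rintro rfl; omega, ?_⟩, rfl⟩
    by_contra! hk
    have := h k (by omega)
    have : V k = V j := by omega
    have := V.injective this
    omega
  have := (Finset.card_le_card hsub).trans Finset.card_image_le
  rw [Finset.card_erase_of_mem (by simp; omega)] at this
  simp at this
  omega

lemma exists_lt_of_inversion {i j : ℕ} (hij : i < j) (hi : V i ≤ i) (hV : V j < V i) :
    ∃ k, k < i ∧ V i < V k := by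
  by_contra! h
  have hsub : (insert j (Finset.range (i + 1))).image V ⊆ Finset.range (V i + 1) := by
    intro v hv
    obtain ⟨k, rfl⟩ := V.surjective v
    simp only [Finset.mem_range, Finset.mem_image, Finset.mem_insert, V.apply_eq_iff_eq,
      exists_eq_right] at hv ⊢
    obtain rfl | hk := hv
    · omega
    · obtain rfl | hk := Nat.lt_succ_iff_lt_or_eq.1 hk |>.symm
      · omega
      · have := h k hk
        omega
  have := Finset.card_le_card hsub
  rw [Finset.card_image_of_injective _ V.injective,
    Finset.card_insert_of_notMem (by simp; omega)] at this
  simp at this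
  omega

namespace NoDecreasingTriple

lemma lt_of_excedance (h : NoDecreasingTriple V) {i j : ℕ} (hj : j < V j) (hij : i < j) :
    V i < V j := by
  by_contra! hV
  have hV : V j < V i := hV.lt_of_ne fun e => hij.ne' (V.injective e)
  obtain ⟨k, hk, hk'⟩ := exists_gt_of_inversion hij hj.le hV
  exact h i j k hij hk hk' hV

lemma lt_of_not_excedance (h : NoDecreasingTriple V) {i j : ℕ} (hi : ¬ i < V i) (hij : i < j) :
    V i < V j := by
  by_contra! hV
  have hV : V j < V i := hV.lt_of_ne fun e => hij.ne' (V.injective e)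
  obtain ⟨k, hk, hk'⟩ := exists_lt_of_inversion hij (not_lt.1 hi) hV
  exact h k i j hk hij hV hk'

lemma lowerCount_apply (h : NoDecreasingTriple V) {i : ℕ} (hi : i < V i) :
    lowerCount (stepWord V) (V i) = upperCount (stepWord V) i :=
  count_apply_of_increasing V (p := fun i => (stepWord V i).1) (q := fun i => (stepWord V i).2)
    (fun i => by rw [stepWord_fst, stepWord_snd])
    (fun i j _ hj hij => h.lt_of_excedance ((stepWord_fst V j).1 hj) hij)
    ((stepWord_fst V i).2 hi)

lemma lowerCount_apply_add (h : NoDecreasingTriple V) {i : ℕ} (hi : ¬ i < V i) :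
    lowerCount (stepWord V) (V i) + i = upperCount (stepWord V) i + V i := by
  have h₁ := count_apply_of_increasing V (p := fun i => ¬ (stepWord V i).1)
    (q := fun i => ¬ (stepWord V i).2)
    (fun i => by rw [stepWord_fst, stepWord_snd])
    (fun i j hi _ hij => h.lt_of_not_excedance (fun hi' => hi ((stepWord_fst V i).2 hi')) hij)
    (fun hi' => hi ((stepWord_fst V i).1 hi'))
  have h₂ := count_add_count_not (fun i => (stepWord V i).1 = true) i
  have h₃ := count_add_count_not (fun i => (stepWord V i).2 = true) (V i)
  rw [upperCount, lowerCount]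
  omega

end NoDecreasingTriple

lemma lowerCount_succ_le_upperCount (V : Equiv.Perm ℕ) (j : ℕ) :
    lowerCount (stepWord V) (j + 1) ≤ upperCount (stepWord V) j := by
  rw [lowerCount, upperCount, Nat.count_eq_card_filter_range, Nat.count_eq_card_filter_range]
  refine Finset.card_le_card_of_injOn V.symm (fun v hv => ?_) V.symm.injective.injOn
  obtain ⟨i, rfl⟩ := V.surjective v
  simp only [Finset.coe_filter, Finset.mem_range, Set.mem_ofPred_eq, stepWord_snd, stepWord_fst,
    Equiv.symm_apply_apply] at hv ⊢
  omega

lemma upperCount_eq_lowerCount {n : ℕ} (hV : ∀ i, n ≤ i → V i = i) {j : ℕ} (hj : n ≤ j) :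
    upperCount (stepWord V) j = lowerCount (stepWord V) j := by
  refine le_antisymm ?_ <| (lowerCount_add_le _ j.le_succ).1.trans
    (lowerCount_succ_le_upperCount V j)
  rw [lowerCount, upperCount, Nat.count_eq_card_filter_range, Nat.count_eq_card_filter_range]
  refine Finset.card_le_card_of_injOn V (fun i hi => ?_) V.injective.injOn
  simp only [Finset.coe_filter, Finset.mem_range, Set.mem_ofPred_eq, stepWord_snd,
    stepWord_fst] at hi ⊢
  refine ⟨?_, hi.2⟩
  by_contra! h
  have := V.injective (hV _ (hj.trans h))
  omega

/-- `V` contains two increasing sequences of length four, interlaced as in one of the four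
hexagon patterns. -/
def ContainsHexagon (V : ℕ → ℕ) : Prop :=
  ∃ u₁ u₂ u₃ u₄ d₁ d₂ d₃ d₄ : ℕ,
    (u₁ < u₂ ∧ u₂ < u₃ ∧ u₃ < u₄) ∧ (d₁ < d₂ ∧ d₂ < d₃ ∧ d₃ < d₄) ∧
    (V u₁ < V u₂ ∧ V u₂ < V u₃ ∧ V u₃ < V u₄) ∧ (V d₁ < V d₂ ∧ V d₂ < V d₃ ∧ V d₃ < V d₄) ∧
    u₃ < d₁ ∧ u₄ < d₂ ∧ V d₃ < V u₁ ∧ V d₄ < V u₂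

lemma upperCount_lt {i j : ℕ} (hi : i < V i) (hij : i < j) :
    upperCount (stepWord V) i < upperCount (stepWord V) j :=
  upperCount_lt_of_fst ((stepWord_fst V i).2 hi) hij

lemma upperCount_add_lt {i j : ℕ} (hi : ¬ i < V i) (hij : i < j) :
    upperCount (stepWord V) j + i < upperCount (stepWord V) i + j :=
  upperCount_add_lt_of_not_fst (by rwa [stepWord_fst]) hij

lemma lowerCount_lt {i j : ℕ} (hi : i < V i) (hij : V i < j) :
    lowerCount (stepWord V) (V i) < lowerCount (stepWord V) j :=
  lowerCount_lt_of_snd ((stepWord_snd V i).2 hi) hij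

lemma lowerCount_add_lt {i j : ℕ} (hi : ¬ i < V i) (hij : V i < j) :
    lowerCount (stepWord V) j + V i < lowerCount (stepWord V) (V i) + j :=
  lowerCount_add_lt_of_not_snd (by rwa [stepWord_snd]) hij

lemma NoDecreasingTriple.exists_hexagon_counts (h : NoDecreasingTriple V)
    (hex : ContainsHexagon V) :
    ∃ m r, lowerCount (stepWord V) m + 2 ≤ r ∧ r + 1 ≤ upperCount (stepWord V) m ∧
      lowerCount (stepWord V) (m + 2) + 1 ≤ r ∧ r + 2 ≤ upperCount (stepWord V) (m + 2) := by
  obtain ⟨u₁, u₂, u₃, u₄, d₁, d₂, d₃, d₄, ⟨hu₁, hu₂, hu₃⟩, ⟨hd₁, hd₂, hd₃⟩, ⟨hU₁, hU₂, hU₃⟩,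
    ⟨hD₁, hD₂, hD₃⟩, h₁, h₂, h₃, h₄⟩ := hex
  have exc : ∀ {i j}, i < j → V j < V i → i < V i ∧ ¬ j < V j := fun hij hV =>
    ⟨by_contra fun hi => lt_asymm hV (h.lt_of_not_excedance hi hij),
      fun hj => lt_asymm hV (h.lt_of_excedance hj hij)⟩
  obtain ⟨e₁, f₁⟩ := exc (i := u₁) (j := d₁) (by omega) (by omega)
  obtain ⟨e₂, f₂⟩ := exc (i := u₂) (j := d₂) (by omega) (by omega)
  obtain ⟨e₃, f₃⟩ := exc (i := u₃) (j := d₃) (by omega) (by omega)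
  obtain ⟨e₄, f₄⟩ := exc (i := u₄) (j := d₄) (by omega) (by omega)
  have := upperCount_lt e₁ hu₁
  have := upperCount_lt e₂ hu₂
  have := upperCount_lt e₃ hu₃
  have := upperCount_lt e₃ h₁
  have := upperCount_lt e₄ h₂
  have := upperCount_add_lt f₁ hd₁
  have := upperCount_add_lt f₂ hd₂
  have := upperCount_add_lt f₃ hd₃
  have := h.lowerCount_apply e₁
  have := h.lowerCount_apply e₂
  have := h.lowerCount_apply_add f₃
  have := h.lowerCount_apply_add f₄
  have := lowerCount_add_lt f₃ h₃
  have := lowerCount_add_lt f₄ h₄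
  have hd₂' : upperCount (stepWord V) d₂ ≤ d₂ := Nat.count_le _
  obtain ⟨m, hm⟩ : ∃ m, m + upperCount (stepWord V) d₂ = upperCount (stepWord V) u₃ + d₂ :=
    ⟨_, Nat.sub_add_cancel (by omega)⟩
  have lipA := fun i j => (le_total i j).imp (fun h => And.intro h <|
    upperCount_add_le (stepWord V) h) fun h => And.intro h <| upperCount_add_le (stepWord V) h
  have lipB := fun i j => (le_total i j).imp (fun h => And.intro h <|
    lowerCount_add_le (stepWord V) h) fun h => And.intro h <| lowerCount_add_le (stepWord V) h
  refine ⟨m, upperCount (stepWord V) u₃, ?_, ?_, ?_, ?_⟩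
  · have := lipB (V u₁) m
    omega
  · have := lipA d₁ m
    omega
  · have := lipB (V u₂) (m + 2)
    omega
  · have := lipA d₂ (m + 2)
    omega

lemma NoDecreasingTriple.containsHexagon (h : NoDecreasingTriple V) {m r : ℕ}
    (h₁ : lowerCount (stepWord V) m + 2 ≤ r) (h₂ : r + 1 ≤ upperCount (stepWord V) m)
    (h₃ : lowerCount (stepWord V) (m + 2) + 1 ≤ r)
    (h₄ : r + 2 ≤ upperCount (stepWord V) (m + 2)) : ContainsHexagon V := by
  have upper : ∀ k < r + 2, ∃ u, u < V u ∧ upperCount (stepWord V) u = k := by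
    intro k hk
    obtain ⟨u, -, hu, huk⟩ := exists_count_eq (p := fun i => (stepWord V i).1)
      (hk.trans_le h₄)
    exact ⟨u, (stepWord_fst V u).1 hu, huk⟩
  have lower : ∀ k, k + r < m + 3 → ∃ d, ¬ d < V d ∧ d = upperCount (stepWord V) d + k := by
    intro k hk
    have hc := count_add_count_not (fun i => (stepWord V i).2 = true) (m + 2)
    rw [lowerCount] at h₃
    obtain ⟨v, -, hv, hvk⟩ := exists_count_eq (p := fun i => ¬ (stepWord V i).2 = true)
      (k := k) (n := m + 2) (by omega)
    obtain ⟨d, rfl⟩ := V.surjective v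
    rw [stepWord_snd] at hv
    have hd := h.lowerCount_apply_add hv
    have hc := count_add_count_not (fun i => (stepWord V i).2 = true) (V d)
    rw [lowerCount] at hd
    exact ⟨d, hv, by omega⟩
  have hm : upperCount (stepWord V) m ≤ m := Nat.count_le _
  obtain ⟨s, rfl⟩ : ∃ s, m = s + r + 1 := ⟨m - r - 1, by omega⟩
  obtain ⟨r, rfl⟩ : ∃ q, r = q + 2 := ⟨r - 2, by omega⟩
  obtain ⟨u₁, eu₁, cu₁⟩ := upper r (by omega)
  obtain ⟨u₂, eu₂, cu₂⟩ := upper (r + 1) (by omega)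
  obtain ⟨u₃, eu₃, cu₃⟩ := upper (r + 2) (by omega)
  obtain ⟨u₄, eu₄, cu₄⟩ := upper (r + 3) (by omega)
  obtain ⟨d₁, ed₁, cd₁⟩ := lower s (by omega)
  obtain ⟨d₂, ed₂, cd₂⟩ := lower (s + 1) (by omega)
  obtain ⟨d₃, ed₃, cd₃⟩ := lower (s + 2) (by omega)
  obtain ⟨d₄, ed₄, cd₄⟩ := lower (s + 3) (by omega)
  have ulip := fun i j => (le_total i j).imp (fun h => And.intro h <|
    upperCount_add_le (stepWord V) h) fun h => And.intro h <| upperCount_add_le (stepWord V) h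
  have hu₁ : u₁ < u₂ := by have := ulip u₁ u₂; omega
  have hu₂ : u₂ < u₃ := by have := ulip u₂ u₃; omega
  have hu₃ : u₃ < u₄ := by have := ulip u₃ u₄; omega
  have hd₁ : d₁ < d₂ := by have := ulip d₁ d₂; omega
  have hd₂ : d₂ < d₃ := by have := ulip d₂ d₃; omega
  have hd₃ : d₃ < d₄ := by have := ulip d₃ d₄; omega
  have hU₁ := h.lowerCount_apply eu₁
  have hU₂ := h.lowerCount_apply eu₂
  have hD₃ := h.lowerCount_apply_add ed₃
  have hD₄ := h.lowerCount_apply_add ed₄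
  refine ⟨u₁, u₂, u₃, u₄, d₁, d₂, d₃, d₄, ⟨hu₁, hu₂, hu₃⟩, ⟨hd₁, hd₂, hd₃⟩,
    ⟨h.lt_of_excedance eu₂ hu₁, h.lt_of_excedance eu₃ hu₂, h.lt_of_excedance eu₄ hu₃⟩,
    ⟨h.lt_of_not_excedance ed₁ hd₁, h.lt_of_not_excedance ed₂ hd₂,
      h.lt_of_not_excedance ed₃ hd₃⟩, ?_, ?_, ?_, ?_⟩
  · have := ulip u₃ (s + (r + 2) + 1)
    have : ¬ d₁ < s + (r + 2) + 1 := fun hlt => by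
      have := upperCount_add_lt ed₁ hlt
      omega
    omega
  · have := ulip u₄ (s + (r + 2) + 1 + 2)
    have : ¬ d₂ < s + (r + 2) + 1 + 2 := fun hlt => by
      have := upperCount_add_lt ed₂ hlt
      omega
    omega
  · have : ¬ V u₁ < s + (r + 2) + 1 := fun hlt => by
      have := lowerCount_lt eu₁ hlt
      omega
    have := fun h => lowerCount_add_le (stepWord V) (i := s + (r + 2) + 1) (j := V d₃) h
    omega
  · have : ¬ V u₂ < s + (r + 2) + 1 + 2 := fun hlt => by
      have := lowerCount_lt eu₂ hlt
      omega
    have := fun h => lowerCount_add_le (stepWord V) (i := s + (r + 2) + 1 + 2) (j := V d₄) h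
    omega

lemma NoDecreasingTriple.admissible_iff (h : NoDecreasingTriple V) {n : ℕ}
    (hV : ∀ i, n ≤ i → V i = i) : Admissible (stepWord V) n ↔ ¬ ContainsHexagon V := by
  constructor
  · rintro ⟨-, ha, hb⟩ hex
    obtain ⟨m, r, h₁, h₂, h₃, h₄⟩ := h.exists_hexagon_counts hex
    by_cases hm : m + 2 ≤ n
    · have := ha m (by omega)
      have := ha (m + 2) hm
      have := hb m hm
      omega
    · have := upperCount_eq_lowerCount hV (by omega : n ≤ m + 2)
      omega
  · intro hex
    refine ⟨fun j _ => lowerCount_succ_le_upperCount V j, fun j _ => ?_, fun m _ hm => ?_⟩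
    · by_contra! hj
      obtain _ | m := j
      · simp [upperCount] at hj
      · have h₁ := upperCount_add_le (stepWord V) m.le_succ
        have h₂ := lowerCount_add_le (stepWord V) m.le_succ
        have h₃ := upperCount_add_le (stepWord V) (m + 1).le_succ
        have h₄ := lowerCount_add_le (stepWord V) (m + 1).le_succ
        simp only [Nat.succ_eq_add_one, add_assoc, Nat.reduceAdd] at h₁ h₂ h₃ h₄
        exact hex (h.containsHexagon (m := m) (r := upperCount (stepWord V) (m + 1) - 2)
          (by omega) (by omega) (by omega) (by omega))
    · exact hex (h.containsHexagon (m := m) (r := upperCount (stepWord V) m - 1)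
        (by omega) (by omega) (by omega) (by omega))

end

/-- A permutation of `Fin n`, extended to `ℕ` by fixing the other numbers. -/
def extendPerm {n : ℕ} (w : Equiv.Perm (Fin n)) : Equiv.Perm ℕ :=
  w.extendDomain Fin.equivSubtype

lemma extendPerm_val {n : ℕ} (w : Equiv.Perm (Fin n)) (i : Fin n) :
    extendPerm w i = w i :=
  Equiv.Perm.extendDomain_apply_image w Fin.equivSubtype i

lemma extendPerm_of_le {n : ℕ} (w : Equiv.Perm (Fin n)) {i : ℕ} (hi : n ≤ i) :
    extendPerm w i = i :=
  Equiv.Perm.extendDomain_apply_not_subtype w Fin.equivSubtype (not_lt.2 hi)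

lemma lt_of_inversion {n : ℕ} (w : Equiv.Perm (Fin n)) {i j : ℕ} (hij : i < j)
    (hV : extendPerm w j < extendPerm w i) : j < n := by
  by_contra! hj
  rw [extendPerm_of_le w hj] at hV
  rw [extendPerm_of_le w (i := i)] at hV
  · omega
  by_contra! hi
  have := (w ⟨i, hi⟩).2
  have := extendPerm_val w ⟨i, hi⟩
  simp only at this
  omega

lemma containsPattern_iff {n k : ℕ} (w : Equiv.Perm (Fin n)) {p : Equiv.Perm (Fin k)}
    (g : Fin k → Fin k) (hg : ∀ a, p (g a) = a) :
    ContainsPattern w p ↔ ∃ f : Fin k → ℕ, StrictMono f ∧ (∀ a, f a < n) ∧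
      StrictMono fun a => extendPerm w (f (g a)) := by
  constructor
  · rintro ⟨f, hf⟩
    refine ⟨fun a => f a, fun a b hab => f.strictMono hab, fun a => (f a).2, fun a b hab => ?_⟩
    simpa [extendPerm_val] using (hf (g a) (g b)).1 (by rwa [hg, hg])
  · rintro ⟨f, hf, hn, hV⟩
    refine ⟨OrderEmbedding.ofStrictMono (fun a => ⟨f a, hn a⟩) fun a b hab => hf hab,
      fun a b => ?_⟩
    have hgp : ∀ a, g (p a) = a := fun a => p.injective (hg _)
    rw [← hV.lt_iff_lt, Fin.lt_def, ← extendPerm_val, ← extendPerm_val]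
    simp only [hgp]
    rfl

lemma avoidsPattern_p321_iff {n : ℕ} (w : Equiv.Perm (Fin n)) :
    AvoidsPattern w p321 ↔ NoDecreasingTriple (extendPerm w) := by
  rw [AvoidsPattern, containsPattern_iff w ![2, 1, 0] (by decide)]
  constructor
  · intro h i j k hij hjk hV hV'
    have hk := lt_of_inversion w hjk hV
    refine h ⟨![i, j, k], ?_, ?_, ?_⟩
    · simp [Fin.strictMono_iff_lt_succ, Fin.forall_fin_succ, hij, hjk]
    · simp only [Fin.forall_fin_succ]
      simp
      omega
    · simp [Fin.strictMono_iff_lt_succ, Fin.forall_fin_succ, hV, hV']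
  · rintro h ⟨f, hf, -, hV⟩
    exact h (f 0) (f 1) (f 2) (hf (by decide)) (hf (by decide))
      (hV (show (0 : Fin 3) < 1 by decide)) (hV (show (1 : Fin 3) < 2 by decide))

lemma avoidsPattern_hexagons_iff {n : ℕ} (w : Equiv.Perm (Fin n)) :
    (AvoidsPattern w p46718235 ∧ AvoidsPattern w p46781235 ∧
      AvoidsPattern w p56718234 ∧ AvoidsPattern w p56781234) ↔
      ¬ ContainsHexagon (extendPerm w) := by
  simp only [AvoidsPattern, ← not_or]
  rw [not_iff_not, containsPattern_iff w ![3, 5, 6, 0, 7, 1, 2, 4] (by decide),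
    containsPattern_iff w ![4, 5, 6, 0, 7, 1, 2, 3] (by decide),
    containsPattern_iff w ![3, 5, 6, 7, 0, 1, 2, 4] (by decide),
    containsPattern_iff w ![4, 5, 6, 7, 0, 1, 2, 3] (by decide)]
  constructor
  · rintro (⟨f, hf, -, hV⟩ | ⟨f, hf, -, hV⟩ | ⟨f, hf, -, hV⟩ | ⟨f, hf, -, hV⟩)
    · refine ⟨f 0, f 1, f 2, f 4, f 3, f 5, f 6, f 7, ?_⟩
      simp [Fin.strictMono_iff_lt_succ, Fin.forall_fin_succ] at hf hV
      omega
    · refine ⟨f 0, f 1, f 2, f 3, f 4, f 5, f 6, f 7, ?_⟩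
      simp [Fin.strictMono_iff_lt_succ, Fin.forall_fin_succ] at hf hV
      omega
    · refine ⟨f 0, f 1, f 2, f 4, f 3, f 5, f 6, f 7, ?_⟩
      simp [Fin.strictMono_iff_lt_succ, Fin.forall_fin_succ] at hf hV
      omega
    · refine ⟨f 0, f 1, f 2, f 3, f 4, f 5, f 6, f 7, ?_⟩
      simp [Fin.strictMono_iff_lt_succ, Fin.forall_fin_succ] at hf hV
      omega
  · rintro ⟨u₁, u₂, u₃, u₄, d₁, d₂, d₃, d₄, hu, hd, hU, hD, h₁, h₂, h₃, h₄⟩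
    have hn : d₄ < n := lt_of_inversion w (i := u₂) (by omega) h₄
    have hpos : u₄ ≠ d₁ := by rintro rfl; omega
    have hval : extendPerm w u₁ ≠ extendPerm w d₄ := fun e => by
      have := (extendPerm w).injective e
      omega
    have build : ∀ f : Fin 8 → ℕ, StrictMono f → f 7 = d₄ → ∀ a, f a < n := fun f hf h7 a =>
      (hf.monotone (Fin.le_last a)).trans_lt (h7.trans_lt hn)
    obtain hpos | hpos := hpos.lt_or_gt <;> obtain hval | hval := hval.lt_or_gt
    · have hf : StrictMono ![u₁, u₂, u₃, u₄, d₁, d₂, d₃, d₄] := by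
        simp [Fin.strictMono_iff_lt_succ, Fin.forall_fin_succ]
        omega
      refine .inr <| .inl ⟨_, hf, build _ hf rfl, ?_⟩
      simp [Fin.strictMono_iff_lt_succ, Fin.forall_fin_succ]
      omega
    · have hf : StrictMono ![u₁, u₂, u₃, u₄, d₁, d₂, d₃, d₄] := by
        simp [Fin.strictMono_iff_lt_succ, Fin.forall_fin_succ]
        omega
      refine .inr <| .inr <| .inr ⟨_, hf, build _ hf rfl, ?_⟩
      simp [Fin.strictMono_iff_lt_succ, Fin.forall_fin_succ]
      omega
    · have hf : StrictMono ![u₁, u₂, u₃, d₁, u₄, d₂, d₃, d₄] := by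
        simp [Fin.strictMono_iff_lt_succ, Fin.forall_fin_succ]
        omega
      refine .inl ⟨_, hf, build _ hf rfl, ?_⟩
      simp [Fin.strictMono_iff_lt_succ, Fin.forall_fin_succ]
      omega
    · have hf : StrictMono ![u₁, u₂, u₃, d₁, u₄, d₂, d₃, d₄] := by
        simp [Fin.strictMono_iff_lt_succ, Fin.forall_fin_succ]
        omega
      refine .inr <| .inr <| .inl ⟨_, hf, build _ hf rfl, ?_⟩
      simp [Fin.strictMono_iff_lt_succ, Fin.forall_fin_succ]
      omega

lemma extendWord_stepWord {n : ℕ} (w : Equiv.Perm (Fin n)) :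
    extendWord (fun i : Fin n => stepWord (extendPerm w) i) = stepWord (extendPerm w) := by
  ext1 i
  rw [extendWord]
  split_ifs with hi
  · rfl
  · have h := extendPerm_of_le w (not_lt.1 hi)
    have h' : (extendPerm w).symm i = i := by rw [Equiv.symm_apply_eq, h]
    simp [stepWord, h, h']

lemma NoDecreasingTriple.eq_of_stepWord_eq {V W : Equiv.Perm ℕ} (hV : NoDecreasingTriple V)
    (hW : NoDecreasingTriple W) (h : stepWord V = stepWord W) : V = W := by
  ext i
  by_cases hi : i < V i
  · have hi' : i < W i := by rwa [← stepWord_fst, ← h, stepWord_fst]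
    have h₁ := hV.lowerCount_apply hi
    have h₂ := hW.lowerCount_apply hi'
    have h₃ := (stepWord_snd V i).2 hi
    have h₄ := (stepWord_snd W i).2 hi'
    rw [h] at h₁ h₃
    exact Nat.count_injective h₃ h₄ (h₁.trans h₂.symm)
  · have hi' : ¬ i < W i := by rwa [← stepWord_fst, ← h, stepWord_fst]
    have h₁ := hV.lowerCount_apply_add hi
    have h₂ := hW.lowerCount_apply_add hi'
    have h₃ : ¬ (stepWord V (V i)).2 := by rwa [stepWord_snd]
    have h₄ : ¬ (stepWord W (W i)).2 := by rwa [stepWord_snd]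
    rw [h] at h₁ h₃
    obtain hlt | heq | hlt := lt_trichotomy (V i) (W i)
    · have := lowerCount_add_lt_of_not_snd h₃ hlt
      omega
    · exact heq
    · have := lowerCount_add_lt_of_not_snd h₄ hlt
      omega

/-- Sending the `k`-th true upper letter to the `k`-th true lower letter and the `k`-th false
upper letter to the `k`-th false lower letter defines a permutation. -/
lemma exists_perm_of_counts {x : ℕ → Bool × Bool} {n : ℕ}
    (hn : upperCount x n = lowerCount x n) :
    ∃ w : Equiv.Perm (Fin n), ∀ i < n, extendPerm w i < n ∧
      ((x (extendPerm w i)).2 ↔ (x i).1) ∧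
      ((x i).1 → lowerCount x (extendPerm w i) = upperCount x i) ∧
      (¬ (x i).1 → lowerCount x (extendPerm w i) + i = upperCount x i + extendPerm w i) := by
  have hex : ∀ i : Fin n, ∃ v : Fin n, ((x v).2 ↔ (x i).1) ∧
      ((x i).1 → lowerCount x v = upperCount x i) ∧
      (¬ (x i).1 → lowerCount x v + i = upperCount x i + v) := by
    intro i
    by_cases hi : (x i).1 = true
    · have hlt : upperCount x i < lowerCount x n := hn ▸ upperCount_lt_of_fst hi i.2
      obtain ⟨v, hv, hxv, hc⟩ := exists_count_eq hlt
      exact ⟨⟨v, hv⟩, by simp [hxv, hi], fun _ => hc, fun h => absurd hi h⟩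
    · have hlt : Nat.count (fun j => ¬ (x j).1) i < Nat.count (fun j => ¬ (x j).2) n := by
        have h₁ := count_add_count_not (fun j => (x j).1 = true) n
        have h₂ := count_add_count_not (fun j => (x j).2 = true) n
        have h₃ : Nat.count (fun j => ¬ (x j).1) i < Nat.count (fun j => ¬ (x j).1) n :=
          Nat.count_strict_mono (p := fun j => ¬ (x j).1) hi i.2
        rw [upperCount, lowerCount] at hn
        omega
      obtain ⟨v, hv, hxv, hc⟩ := exists_count_eq hlt
      refine ⟨⟨v, hv⟩, by simp_all, fun h => absurd h hi, fun _ => ?_⟩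
      have h₁ := count_add_count_not (fun j => (x j).1 = true) i
      have h₂ := count_add_count_not (fun j => (x j).2 = true) v
      rw [upperCount, lowerCount]
      simp only
      omega
  choose φ h₁ h₂ h₃ using hex
  have hφ : Function.Injective φ := by
    intro i j hij
    have hfst : (x i).1 ↔ (x j).1 := by rw [← h₁, ← h₁, hij]
    rw [Fin.ext_iff]
    by_cases hi : (x i).1 = true
    · have hi' := h₂ i hi
      have hj' := h₂ j (hfst.1 hi)
      rw [hij] at hi'
      exact Nat.count_injective (p := fun i => (x i).1) hi (hfst.1 hi) (hi'.symm.trans hj')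
    · have hj : ¬ (x j).1 := by rwa [← hfst]
      have hi' := h₃ i hi
      have hj' := h₃ j hj
      rw [hij] at hi'
      obtain hlt | heq | hlt := lt_trichotomy (i : ℕ) j
      · have := upperCount_add_lt_of_not_fst hi hlt
        omega
      · exact heq
      · have := upperCount_add_lt_of_not_fst hj hlt
        omega
  refine ⟨Equiv.ofBijective φ (Finite.injective_iff_bijective.1 hφ), fun i hi => ?_⟩
  rw [extendPerm_val _ ⟨i, hi⟩, Equiv.ofBijective_apply]
  exact ⟨(φ ⟨i, hi⟩).2, h₁ ⟨i, hi⟩, h₂ ⟨i, hi⟩, h₃ ⟨i, hi⟩⟩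

lemma exists_perm_of_dominated {n : ℕ} {x : Fin n → Bool × Bool}
    (hdom : ∀ j < n, lowerCount (extendWord x) (j + 1) ≤ upperCount (extendWord x) j)
    (hn : upperCount (extendWord x) n = lowerCount (extendWord x) n) :
    ∃ w : Equiv.Perm (Fin n), NoDecreasingTriple (extendPerm w) ∧
      (fun i : Fin n => stepWord (extendPerm w) i) = x := by
  obtain ⟨w, hw⟩ := exists_perm_of_counts hn
  have hfst : ∀ i < n, (i < extendPerm w i ↔ (extendWord x i).1) := by
    intro i hi
    obtain ⟨hv, hsnd, h₁, h₂⟩ := hw i hi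
    have hd := hdom _ hv
    constructor
    · intro hlt
      by_contra h
      have := upperCount_add_lt_of_not_fst h hlt
      have := h₂ h
      have := (lowerCount_add_le (extendWord x) (Nat.le_add_right (extendPerm w i) 1)).1
      omega
    · intro h
      have := h₁ h
      have := lowerCount_lt_of_snd (hsnd.2 h) (Nat.lt_add_one _)
      by_contra! hle
      have := (upperCount_add_le (extendWord x) hle).1
      omega
  have hmono : ∀ i j, i < j → j < n → ((extendWord x i).1 ↔ (extendWord x j).1) →
      extendPerm w i < extendPerm w j := by
    intro i j hij hj h
    obtain ⟨-, hsndi, hi₁, hi₂⟩ := hw i (hij.trans hj)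
    obtain ⟨-, hsndj, hj₁, hj₂⟩ := hw j hj
    by_contra! hle
    have := lowerCount_add_le (extendWord x) hle
    by_cases hi : (extendWord x i).1 = true
    · have := upperCount_lt_of_fst hi hij
      have := hi₁ hi
      have := hj₁ (h.1 hi)
      omega
    · have := upperCount_add_lt_of_not_fst hi hij
      have := hi₂ hi
      have := hj₂ (by rwa [← h])
      omega
  refine ⟨w, fun i j k hij hjk hV hV' => ?_, ?_⟩
  · have hk := lt_of_inversion w hjk hV
    have h₁ := mt (hmono i j hij (hjk.trans hk)) hV'.not_gt
    have h₂ := mt (hmono j k hjk hk) hV.not_gt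
    have h₃ := mt (hmono i k (hij.trans hjk) hk) (hV.trans hV').not_gt
    tauto
  · ext1 v
    refine Prod.ext (Bool.eq_iff_iff.2 ?_) (Bool.eq_iff_iff.2 ?_)
    · rw [stepWord_fst, hfst v v.2]
      simp [extendWord]
    · obtain ⟨i, rfl⟩ := w.surjective v
      rw [← extendPerm_val, stepWord_snd, hfst i i.2, ← (hw i i.2).2.1, extendPerm_val]
      simp [extendWord]

lemma card_avoiding_eq_wordCount (n : ℕ) :
    Nat.card {w : Equiv.Perm (Fin n) //
      AvoidsPattern w p321 ∧ AvoidsPattern w p46718235 ∧ AvoidsPattern w p46781235 ∧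
      AvoidsPattern w p56718234 ∧ AvoidsPattern w p56781234} = wordCount n .zero := by
  simp only [avoidsPattern_hexagons_iff, avoidsPattern_p321_iff]
  rw [wordCount, ← Nat.card_eq_fintype_card]
  refine Nat.card_eq_of_bijective
    (fun w => ⟨fun i => stepWord (extendPerm w.1) i, ?_⟩) ⟨?_, ?_⟩
  · have hV := fun i => extendPerm_of_le w.1 (i := i)
    rw [extendWord_stepWord, run_eq_zero_iff, w.2.1.admissible_iff hV]
    exact ⟨w.2.2, upperCount_eq_lowerCount hV le_rfl⟩
  · rintro ⟨w, hw, _⟩ ⟨w', hw', _⟩ h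
    have h := congrArg extendWord (Subtype.ext_iff.1 h)
    simp only [extendWord_stepWord] at h
    have h := hw.eq_of_stepWord_eq hw' h
    rw [Subtype.mk_eq_mk]
    ext i
    rw [← extendPerm_val, h, extendPerm_val]
  · rintro ⟨x, hx⟩
    obtain ⟨hadm, hn⟩ := (run_eq_zero_iff _ _).1 hx
    obtain ⟨w, hw, rfl⟩ := exists_perm_of_dominated hadm.1 hn
    rw [extendWord_stepWord, hw.admissible_iff fun i => extendPerm_of_le w] at hadm
    exact ⟨⟨w, hw, hadm⟩, rfl⟩

/-- The number `c n` of 321-hexagon-avoiding permutations in `S_n` (avoiding 321, 46718235,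
46781235, 56718234, 56781234) satisfies
`c (n+1) = 6 c n - 11 c (n-1) + 9 c (n-2) - 4 c (n-3) - 4 c (n-4) + c (n-5)` for `n ≥ 8`,
with initial values `c 3 = 5, c 4 = 14, c 5 = 42, c 6 = 132, c 7 = 429, c 8 = 1426,
c 9 = 4806`. -/
theorem stmt_11
    (c : ℕ → ℕ)
    (hc : ∀ n, c n = Nat.card {w : Equiv.Perm (Fin n) //
      AvoidsPattern w p321 ∧ AvoidsPattern w p46718235 ∧ AvoidsPattern w p46781235 ∧
      AvoidsPattern w p56718234 ∧ AvoidsPattern w p56781234}) :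
    (∀ n, 8 ≤ n → (c (n + 1) : ℤ) =
      6 * c n - 11 * c (n - 1) + 9 * c (n - 2) - 4 * c (n - 3) - 4 * c (n - 4) + c (n - 5)) ∧
    c 3 = 5 ∧ c 4 = 14 ∧ c 5 = 42 ∧ c 6 = 132 ∧ c 7 = 429 ∧ c 8 = 1426 ∧ c 9 = 4806 := by
  obtain rfl : c = fun n => wordCount n .zero :=
    funext fun n => (hc n).trans (card_avoiding_eq_wordCount n)
  refine ⟨fun n hn => ?_, wordCount_initial⟩
  obtain ⟨k, rfl⟩ := Nat.exists_eq_add_of_le' (show 5 ≤ n by omega)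
  exact wordCount_recurrence k
end

section
/- The number m_n of permutations of {1,...,n} avoiding the patterns 3421, 4312, 4321, 46718235, 46781235, 56718234, 56781234 satisfies m_{n+1} = 7m_n − 15m_{n−1} + 14m_{n−2} − 8m_{n−3} − 4m_{n−4} + 3m_{n−5} for all n ≥ 9, with initial values m_3 = 6, m_4 = 21, m_5 = 78, m_6 = 298, m_7 = 1157, m_8 = 4535, m_9 = 17872, m_10 = 70644. -/
namespace ClusteredHexagon

/-- The type of an index `j` of a permutation `w`, recording how `j` compares with `w j` and with
`w⁻¹ j`: `U` if both are larger, `D` if both are smaller, `A` if only `w⁻¹ j` is larger,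
`B` if only `w j` is larger, `F` if `j` is fixed. -/
inductive Letter
  | U | D | A | B | F
  deriving DecidableEq

instance : Fintype Letter := ⟨{.U, .D, .A, .B, .F}, fun a => by cases a <;> decide⟩

namespace Letter

/-- The letter of an index `j` with `j < w j`. -/
def rises : Letter → Bool
  | U | B => true
  | _ => false

/-- The letter of an index `j` with `w j < j`. -/
def falls : Letter → Bool
  | D | A => true
  | _ => false

/-- The letter of an index `j` with `j < w⁻¹ j`. -/
def opens : Letter → Bool
  | U | A => true
  | _ => false

/-- The letter of an index `j` with `w⁻¹ j < j`. -/
def closes : Letter → Bool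
  | D | B => true
  | _ => false

end Letter

/-- The states of the automaton reading the letters of a permutation. The digit is the number of
indices crossing the current cut, the suffix remembers the previous letter where it matters. -/
inductive State
  | h0 | h1 | h2 | h2D | h3 | h3A | h3B | sink
  deriving DecidableEq

namespace State

/-- The transition function. -/
def next : State → Letter → State
  | h0, .F => h0
  | h0, .U => h1
  | h1, .F => h1
  | h1, .A => h1
  | h1, .B => h1
  | h1, .U => h2
  | h1, .D => h0
  | h2, .A => h2
  | h2, .B => h2
  | h2, .U => h3
  | h2, .D => h1
  | h2D, .A => h2
  | h2D, .B => h2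
  | h2D, .D => h1
  | h3, .A => h3A
  | h3, .B => h3B
  | h3, .D => h2D
  | h3A, .A => h3A
  | h3A, .D => h2D
  | h3B, .B => h3B
  | h3B, .D => h2D
  | _, _ => sink

/-- The number of indices crossing the current cut. -/
def height : State → ℕ
  | h0 => 0
  | h1 => 1
  | h2 => 2
  | h2D => 2
  | h3 => 3
  | h3A => 3
  | h3B => 3
  | sink => 0

/-- The state reached from `s` after reading a list of letters. -/
def run (s : State) (l : List Letter) : State := l.foldl next s

theorem run_sink (l : List Letter) : run sink l = sink := by
  induction l with
  | nil => rfl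
  | cons a l ih => simpa [run, next] using ih

/-- The number of words of length `n` leading from `s` to the state `h0`. -/
def count (n : ℕ) (s : State) : ℕ :=
  Fintype.card {v : Fin n → Letter // run s (List.ofFn v) = h0}

theorem count_zero (s : State) : count 0 s = if s = h0 then 1 else 0 := by
  rw [count, Fintype.card_subtype, Finset.card_filter]
  simp [run]

theorem count_succ (n : ℕ) (s : State) :
    count (n + 1) s = ∑ a : Letter, count n (next s a) := by
  simp only [count, Fintype.card_subtype, Finset.card_filter]
  rw [← (Fin.consEquiv fun _ => Letter).sum_comp, Fintype.sum_prod_type]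
  simp [-Finset.sum_boole, Fin.consEquiv, List.ofFn_succ, run]
  rfl

theorem sum_letter (f : Letter → ℕ) :
    ∑ a : Letter, f a = f .U + f .D + f .A + f .B + f .F := by
  have h : (Finset.univ : Finset Letter) = {.U, .D, .A, .B, .F} := by decide
  rw [h]
  simp [add_assoc]

theorem count_sink (n : ℕ) : count n sink = 0 := by
  rw [count, Fintype.card_eq_zero_iff]
  exact ⟨fun v => by simpa [run_sink] using v.2⟩

theorem count_succ_h0 (n : ℕ) : count (n + 1) h0 = count n h0 + count n h1 := by
  simp [count_succ, sum_letter, next, count_sink]; ring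

theorem count_succ_h1 (n : ℕ) :
    count (n + 1) h1 = count n h0 + 3 * count n h1 + count n h2 := by
  simp [count_succ, sum_letter, next]; ring

theorem count_succ_h2 (n : ℕ) :
    count (n + 1) h2 = count n h1 + 2 * count n h2 + count n h3 := by
  simp [count_succ, sum_letter, next, count_sink]; ring

theorem count_succ_h2D (n : ℕ) :
    count (n + 1) h2D = count n h1 + 2 * count n h2 := by
  simp [count_succ, sum_letter, next, count_sink]; ring

theorem count_succ_h3 (n : ℕ) :
    count (n + 1) h3 = count n h2D + count n h3A + count n h3B := by
  simp [count_succ, sum_letter, next, count_sink]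

theorem count_succ_h3A (n : ℕ) : count (n + 1) h3A = count n h2D + count n h3A := by
  simp [count_succ, sum_letter, next, count_sink]

theorem count_succ_h3B (n : ℕ) : count (n + 1) h3B = count n h2D + count n h3B := by
  simp [count_succ, sum_letter, next, count_sink]

theorem count_recurrence (n : ℕ) :
    (count (n + 6) h0 : ℤ) = 7 * count (n + 5) h0 - 15 * count (n + 4) h0
      + 14 * count (n + 3) h0 - 8 * count (n + 2) h0 - 4 * count (n + 1) h0
      + 3 * count n h0 := by
  simp only [count_succ_h0, count_succ_h1, count_succ_h2, count_succ_h2D, count_succ_h3,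
    count_succ_h3A, count_succ_h3B]
  push_cast
  ring

theorem count_h0_values :
    count 3 h0 = 6 ∧ count 4 h0 = 21 ∧ count 5 h0 = 78 ∧ count 6 h0 = 298 ∧
      count 7 h0 = 1157 ∧ count 8 h0 = 4535 ∧ count 9 h0 = 17872 ∧ count 10 h0 = 70644 := by
  simp [count_succ_h0, count_succ_h1, count_succ_h2, count_succ_h2D, count_succ_h3,
    count_succ_h3A, count_succ_h3B, count_zero]

theorem run_take_succ (s : State) {n : ℕ} (v : Fin n → Letter) (t : Fin n) :
    run s ((List.ofFn v).take (t + 1)) = next (run s ((List.ofFn v).take t)) (v t) := by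
  simp [run, List.take_add_one]

theorem run_take_ne_sink {s : State} {n : ℕ} {v : Fin n → Letter}
    (h : run s (List.ofFn v) = h0) (t : ℕ) : run s ((List.ofFn v).take t) ≠ sink := by
  intro h'
  rw [← List.take_append_drop t (List.ofFn v), run, List.foldl_append] at h
  rw [run] at h'
  rw [h'] at h
  exact absurd ((run_sink _).symm.trans h) (by decide)

end State

open Finset

section Crossings

variable {n : ℕ}

/-- The indices `i < t` with `t ≤ w i`. -/
def crossing (w : Equiv.Perm (Fin n)) (t : ℕ) : Finset (Fin n) :=
  univ.filter fun i => (i : ℕ) < t ∧ t ≤ (w i : ℕ)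

theorem mem_crossing {w : Equiv.Perm (Fin n)} {t : ℕ} {i : Fin n} :
    i ∈ crossing w t ↔ (i : ℕ) < t ∧ t ≤ (w i : ℕ) := by
  simp [crossing]

/-- As many indices cross a cut upwards as downwards. -/
theorem card_crossing_symm (w : Equiv.Perm (Fin n)) (t : ℕ) :
    #(crossing w.symm t) = #(crossing w t) := by
  have h₁ : #(univ.filter fun i : Fin n => (w i : ℕ) < t) =
      #(univ.filter fun i : Fin n => (i : ℕ) < t) := card_equiv w (by simp)
  have h₂ : #(crossing w.symm t) =
      #(univ.filter fun i : Fin n => (w i : ℕ) < t ∧ t ≤ (i : ℕ)) :=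
    card_equiv w.symm (by simp [crossing])
  rw [← card_filter_add_card_filter_not (fun i : Fin n => (i : ℕ) < t),
    ← card_filter_add_card_filter_not (s := univ.filter fun i : Fin n => (i : ℕ) < t)
      (fun i : Fin n => (w i : ℕ) < t)] at h₁
  simp only [filter_filter, not_lt] at h₁
  simp only [and_comm (a := (w _ : ℕ) < t) (b := (_ : ℕ) < t)] at h₁
  rw [h₂, crossing]
  omega

theorem card_crossing_succ (w : Equiv.Perm (Fin n)) (t : Fin n) :
    #(crossing w (t + 1)) + (if w.symm t < t then 1 else 0) =
      #(crossing w t) + (if t < w t then 1 else 0) := by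
  set X : Finset (Fin n) := univ.filter fun i => i < t ∧ t < w i with hX
  have h₁ : #(crossing w (t + 1)) = #X + (if t < w t then 1 else 0) := by
    split_ifs with h
    · rw [← card_insert_of_notMem (a := t) (by simp [hX])]
      congr 1
      ext i
      simp only [mem_crossing, hX, mem_insert, mem_filter, mem_univ, true_and, Fin.lt_def,
        Fin.ext_iff] at h ⊢
      constructor
      · intro h'
        omega
      · rintro (h' | h')
        · obtain rfl := Fin.ext h'
          omega
        · omega
    · rw [add_zero]
      congr 1
      ext i
      simp only [mem_crossing, hX, mem_filter, mem_univ, true_and, Fin.lt_def] at h ⊢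
      constructor
      · intro h'
        have : (i : ℕ) ≠ t := fun e => by
          obtain rfl := Fin.ext e
          omega
        omega
      · intro h'
        omega
  have h₂ : #(crossing w t) = #X + (if w.symm t < t then 1 else 0) := by
    have key : ∀ i : Fin n, (w i : ℕ) = t → i = w.symm t := fun i e => by
      rw [← Fin.ext e, Equiv.symm_apply_apply]
    split_ifs with h
    · rw [← card_insert_of_notMem (a := w.symm t) (by simp [hX])]
      congr 1
      ext i
      simp only [mem_crossing, hX, mem_insert, mem_filter, mem_univ, true_and, Fin.lt_def] at h ⊢
      constructor
      · intro h'
        by_cases e : (w i : ℕ) = t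
        · exact Or.inl (key i e)
        · omega
      · rintro (rfl | h')
        · simpa using h
        · omega
    · rw [add_zero]
      congr 1
      ext i
      simp only [mem_crossing, hX, mem_filter, mem_univ, true_and, Fin.lt_def] at h ⊢
      constructor
      · intro h'
        have : (w i : ℕ) ≠ t := fun e => by
          rw [key i e] at h'
          omega
        omega
      · intro h'
        omega
  omega

theorem crossing_zero (w : Equiv.Perm (Fin n)) : crossing w 0 = ∅ := by
  ext i
  simp [mem_crossing]

theorem crossing_self (w : Equiv.Perm (Fin n)) : crossing w n = ∅ := by
  ext i
  simp [mem_crossing]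

theorem exists_lt_of_two_le_card {s : Finset (Fin n)} (h : 2 ≤ #s) :
    ∃ a ∈ s, ∃ b ∈ s, a < b :=
  ⟨_, orderEmbOfCardLe_mem s h 0, _, orderEmbOfCardLe_mem s h 1, by simp⟩

theorem exists_lt_of_three_le_card {s : Finset (Fin n)} (h : 3 ≤ #s) :
    ∃ a ∈ s, ∃ b ∈ s, ∃ c ∈ s, a < b ∧ b < c :=
  ⟨_, orderEmbOfCardLe_mem s h 0, _, orderEmbOfCardLe_mem s h 1, _,
    orderEmbOfCardLe_mem s h 2, by simp, by simp⟩

theorem two_le_card {s : Finset (Fin n)} {a b : Fin n} (ha : a ∈ s) (hb : b ∈ s)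
    (hab : a < b) : 2 ≤ #s :=
  one_lt_card.2 ⟨a, ha, b, hb, hab.ne⟩

theorem three_le_card {s : Finset (Fin n)} {a b c : Fin n} (ha : a ∈ s) (hb : b ∈ s)
    (hc : c ∈ s) (hab : a < b) (hbc : b < c) : 3 ≤ #s :=
  two_lt_card_iff.2 ⟨a, b, c, ha, hb, hc, hab.ne, (hab.trans hbc).ne, hbc.ne⟩

theorem four_le_card {s : Finset (Fin n)} {a b c d : Fin n} (ha : a ∈ s) (hb : b ∈ s)
    (hc : c ∈ s) (hd : d ∈ s) (hab : a < b) (hbc : b < c) (hcd : c < d) : 4 ≤ #s := by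
  have h : #({a, b, c, d} : Finset (Fin n)) = 4 := by
    rw [card_insert_of_notMem, card_insert_of_notMem, card_insert_of_notMem, card_singleton] <;>
      simp only [mem_insert, mem_singleton] <;> omega
  rw [← h]
  exact card_le_card (by simp [insert_subset_iff, *])

end Crossings

section Patterns

variable {n : ℕ}

theorem containsPattern_of_strictMono {k : ℕ} {w : Equiv.Perm (Fin n)} {p : Equiv.Perm (Fin k)}
    (q : Fin k → Fin k) (hq : ∀ a, q (p a) = a) (f : Fin k → Fin n) (hf : StrictMono f)
    (hw : StrictMono fun a => w (f (q a))) : ContainsPattern w p := by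
  refine ⟨OrderEmbedding.ofStrictMono f hf, fun a b => ?_⟩
  have h := hw.lt_iff_lt (a := p a) (b := p b)
  simpa [hq] using h.symm

theorem containsPattern_p3421_iff {w : Equiv.Perm (Fin n)} :
    ContainsPattern w p3421 ↔
      ∃ a b c d, a < b ∧ b < c ∧ c < d ∧ w d < w c ∧ w c < w a ∧ w a < w b := by
  constructor
  · rintro ⟨f, h⟩
    exact ⟨f 0, f 1, f 2, f 3, by simp, by simp, by simp, (h 3 2).1 (by simp [p3421]),
      (h 2 0).1 (by simp [p3421]), (h 0 1).1 (by simp [p3421])⟩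
  · rintro ⟨a, b, c, d, hab, hbc, hcd, h₁, h₂, h₃⟩
    refine containsPattern_of_strictMono ![3, 2, 0, 1] (fun a => by fin_cases a <;> rfl)
      ![a, b, c, d] ?_ ?_ <;>
    · refine Fin.strictMono_iff_lt_succ.2 fun i => ?_
      fin_cases i <;> assumption

theorem containsPattern_p4312_iff {w : Equiv.Perm (Fin n)} :
    ContainsPattern w p4312 ↔
      ∃ a b c d, a < b ∧ b < c ∧ c < d ∧ w c < w d ∧ w d < w b ∧ w b < w a := by
  constructor
  · rintro ⟨f, h⟩
    exact ⟨f 0, f 1, f 2, f 3, by simp, by simp, by simp, (h 2 3).1 (by simp [p4312]),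
      (h 3 1).1 (by simp [p4312]), (h 1 0).1 (by simp [p4312])⟩
  · rintro ⟨a, b, c, d, hab, hbc, hcd, h₁, h₂, h₃⟩
    refine containsPattern_of_strictMono ![2, 3, 1, 0] (fun a => by fin_cases a <;> rfl)
      ![a, b, c, d] ?_ ?_ <;>
    · refine Fin.strictMono_iff_lt_succ.2 fun i => ?_
      fin_cases i <;> assumption

theorem containsPattern_p4321_iff {w : Equiv.Perm (Fin n)} :
    ContainsPattern w p4321 ↔
      ∃ a b c d, a < b ∧ b < c ∧ c < d ∧ w d < w c ∧ w c < w b ∧ w b < w a := by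
  constructor
  · rintro ⟨f, h⟩
    exact ⟨f 0, f 1, f 2, f 3, by simp, by simp, by simp, (h 3 2).1 (by simp [p4321]),
      (h 2 1).1 (by simp [p4321]), (h 1 0).1 (by simp [p4321])⟩
  · rintro ⟨a, b, c, d, hab, hbc, hcd, h₁, h₂, h₃⟩
    refine containsPattern_of_strictMono ![3, 2, 1, 0] (fun a => by fin_cases a <;> rfl)
      ![a, b, c, d] ?_ ?_ <;>
    · refine Fin.strictMono_iff_lt_succ.2 fun i => ?_
      fin_cases i <;> assumption

/-- The common weakening of the four hexagon patterns: two increasing chains, the second one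
essentially to the right of and below the first one. -/
structure IsHexagon (w : Equiv.Perm (Fin n)) (e₁ e₂ e₃ e₄ d₁ d₂ d₃ d₄ : Fin n) : Prop where
  e₁₂ : e₁ < e₂
  e₂₃ : e₂ < e₃
  e₃₄ : e₃ < e₄
  d₁₂ : d₁ < d₂
  d₂₃ : d₂ < d₃
  d₃₄ : d₃ < d₄
  e₃_d₁ : e₃ < d₁
  e₄_d₂ : e₄ < d₂
  w_e₁₂ : w e₁ < w e₂
  w_e₂₃ : w e₂ < w e₃
  w_e₃₄ : w e₃ < w e₄
  w_d₁₂ : w d₁ < w d₂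
  w_d₂₃ : w d₂ < w d₃
  w_d₃₄ : w d₃ < w d₄
  w_d₃_e₁ : w d₃ < w e₁
  w_d₄_e₂ : w d₄ < w e₂

/-- `w` contains one of the four hexagon patterns. -/
def HasHexagon (w : Equiv.Perm (Fin n)) : Prop :=
  ∃ e₁ e₂ e₃ e₄ d₁ d₂ d₃ d₄, IsHexagon w e₁ e₂ e₃ e₄ d₁ d₂ d₃ d₄

theorem hasHexagon_iff {w : Equiv.Perm (Fin n)} :
    HasHexagon w ↔ ContainsPattern w p46718235 ∨ ContainsPattern w p46781235 ∨
      ContainsPattern w p56718234 ∨ ContainsPattern w p56781234 := by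
  constructor
  · rintro ⟨e₁, e₂, e₃, e₄, d₁, d₂, d₃, d₄, h⟩
    cases h
    have h₁ : e₄ ≠ d₁ := by
      rintro rfl
      omega
    have h₂ : w e₁ ≠ w d₄ := fun h => by
      have := w.injective h
      omega
    rcases h₁.lt_or_gt with h₁ | h₁ <;> rcases h₂.lt_or_gt with h₂ | h₂
    · refine Or.inr (Or.inl (containsPattern_of_strictMono ![4, 5, 6, 0, 7, 1, 2, 3]
        (fun a => by fin_cases a <;> rfl) ![e₁, e₂, e₃, e₄, d₁, d₂, d₃, d₄] ?_ ?_)) <;>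
      · refine Fin.strictMono_iff_lt_succ.2 fun i => ?_
        fin_cases i <;> assumption
    · refine Or.inr (Or.inr (Or.inr (containsPattern_of_strictMono ![4, 5, 6, 7, 0, 1, 2, 3]
        (fun a => by fin_cases a <;> rfl) ![e₁, e₂, e₃, e₄, d₁, d₂, d₃, d₄] ?_ ?_))) <;>
      · refine Fin.strictMono_iff_lt_succ.2 fun i => ?_
        fin_cases i <;> assumption
    · refine Or.inl (containsPattern_of_strictMono ![3, 5, 6, 0, 7, 1, 2, 4]
        (fun a => by fin_cases a <;> rfl) ![e₁, e₂, e₃, d₁, e₄, d₂, d₃, d₄] ?_ ?_) <;>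
      · refine Fin.strictMono_iff_lt_succ.2 fun i => ?_
        fin_cases i <;> assumption
    · refine Or.inr (Or.inr (Or.inl (containsPattern_of_strictMono ![3, 5, 6, 7, 0, 1, 2, 4]
        (fun a => by fin_cases a <;> rfl) ![e₁, e₂, e₃, d₁, e₄, d₂, d₃, d₄] ?_ ?_))) <;>
      · refine Fin.strictMono_iff_lt_succ.2 fun i => ?_
        fin_cases i <;> assumption
  · rintro (⟨f, h⟩ | ⟨f, h⟩ | ⟨f, h⟩ | ⟨f, h⟩)
    · refine ⟨f 0, f 1, f 2, f 4, f 3, f 5, f 6, f 7, ?_⟩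
      constructor <;> first | exact f.strictMono (by decide) | exact (h _ _).1 (by simp [p46718235])
    · refine ⟨f 0, f 1, f 2, f 3, f 4, f 5, f 6, f 7, ?_⟩
      constructor <;> first | exact f.strictMono (by decide) | exact (h _ _).1 (by simp [p46781235])
    · refine ⟨f 0, f 1, f 2, f 4, f 3, f 5, f 6, f 7, ?_⟩
      constructor <;> first | exact f.strictMono (by decide) | exact (h _ _).1 (by simp [p56718234])
    · refine ⟨f 0, f 1, f 2, f 3, f 4, f 5, f 6, f 7, ?_⟩
      constructor <;> first | exact f.strictMono (by decide) | exact (h _ _).1 (by simp [p56781234])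

/-- The permutations avoiding 3421, 4312 and 4321, see `isClustered_iff`. -/
structure IsClustered (w : Equiv.Perm (Fin n)) : Prop where
  rise : ∀ i j, i < j → i < w i → j < w j → w i < w j
  fall : ∀ i j, i < j → w i < i → w j < j → w i < w j
  fixed : ∀ j, w j = j → #(crossing w j) ≤ 1

theorem apply_mem_crossing_symm {w : Equiv.Perm (Fin n)} {t : ℕ} {i : Fin n} :
    w i ∈ crossing w.symm t ↔ (w i : ℕ) < t ∧ t ≤ (i : ℕ) := by
  simp [mem_crossing]

theorem two_le_card_crossing_of_falls {w : Equiv.Perm (Fin n)} {t : ℕ} {i j : Fin n}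
    (hij : i ≠ j) (hi : t ≤ i) (hj : t ≤ j) (hi' : w i < t) (hj' : w j < t) :
    2 ≤ #(crossing w t) := by
  rw [← card_crossing_symm]
  exact one_lt_card.2 ⟨w i, apply_mem_crossing_symm.2 ⟨hi', hi⟩, w j,
    apply_mem_crossing_symm.2 ⟨hj', hj⟩, w.injective.ne hij⟩

theorem exists_rises {w : Equiv.Perm (Fin n)} {t : ℕ} (h : 2 ≤ #(crossing w t)) :
    ∃ p q : Fin n, p < q ∧ q < t ∧ t ≤ w p ∧ t ≤ w q := by
  obtain ⟨p, hp, q, hq, hpq⟩ := exists_lt_of_two_le_card h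
  rw [mem_crossing] at hp hq
  exact ⟨p, q, hpq, hq.1, hp.2, hq.2⟩

theorem exists_falls {w : Equiv.Perm (Fin n)} {t : ℕ} (h : 2 ≤ #(crossing w t)) :
    ∃ p q : Fin n, p < q ∧ t ≤ p ∧ w p < t ∧ w q < t := by
  rw [← card_crossing_symm] at h
  obtain ⟨u, hu, v, hv, huv⟩ := exists_lt_of_two_le_card h
  rw [mem_crossing] at hu hv
  rcases (w.symm.injective.ne huv.ne).lt_or_gt with h | h
  · exact ⟨_, _, h, hu.2, by simpa using hu.1, by simpa using hv.1⟩
  · exact ⟨_, _, h, hv.2, by simpa using hv.1, by simpa using hu.1⟩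

theorem isClustered_iff {w : Equiv.Perm (Fin n)} :
    IsClustered w ↔ AvoidsPattern w p3421 ∧ AvoidsPattern w p4312 ∧ AvoidsPattern w p4321 := by
  rw [AvoidsPattern, AvoidsPattern, AvoidsPattern, containsPattern_p3421_iff,
    containsPattern_p4312_iff, containsPattern_p4321_iff]
  constructor
  · intro h
    have left : ∀ a b c d, a < b → b < c → c < d → w d < w c → w c < w a → w c < w b → False := by
      intro a b c d hab hbc hcd hdc hca hcb
      rcases lt_trichotomy (w c) c with hc | hc | hc
      · have := h.fall c d hcd hc (by omega)
        omega
      · have := h.fixed c hc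
        have : 2 ≤ #(crossing w c) := two_le_card (a := a) (b := b)
          (mem_crossing.2 (by omega)) (mem_crossing.2 (by omega)) hab
        omega
      · have := h.rise a c (by omega) (by omega) hc
        omega
    have right : ∀ a b c d, a < b → b < c → c < d → w b < w a → w c < w b → w d < w b → False := by
      intro a b c d hab hbc hcd hba hcb hdb
      rcases lt_trichotomy (w b) b with hb | hb | hb
      · have := h.fall b d (by omega) hb (by omega)
        omega
      · have := h.fixed b hb
        have : 2 ≤ #(crossing w b) := two_le_card_crossing_of_falls (i := c) (j := d)
          (by omega) (by omega) (by omega) (by omega) (by omega)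
        omega
      · have := h.rise a b hab (by omega) hb
        omega
    refine ⟨?_, ?_, ?_⟩
    · rintro ⟨a, b, c, d, hab, hbc, hcd, h₁, h₂, h₃⟩
      exact left a b c d hab hbc hcd h₁ h₂ (by omega)
    · rintro ⟨a, b, c, d, hab, hbc, hcd, h₁, h₂, h₃⟩
      exact right a b c d hab hbc hcd h₃ (by omega) h₂
    · rintro ⟨a, b, c, d, hab, hbc, hcd, h₁, h₂, h₃⟩
      exact left a b c d hab hbc hcd h₁ (by omega) h₂
  · rintro ⟨h3421, h4312, h4321⟩
    have left : ∀ a b c d, a < b → b < c → c < d → w d < w c → w c < w a → w c < w b → False := by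
      intro a b c d hab hbc hcd hdc hca hcb
      rcases (w.injective.ne hab.ne).lt_or_gt with h | h
      · exact h3421 ⟨a, b, c, d, hab, hbc, hcd, hdc, hca, h⟩
      · exact h4321 ⟨a, b, c, d, hab, hbc, hcd, hdc, hcb, h⟩
    have right : ∀ a b c d, a < b → b < c → c < d → w b < w a → w c < w b → w d < w b → False := by
      intro a b c d hab hbc hcd hba hcb hdb
      rcases (w.injective.ne hcd.ne).lt_or_gt with h | h
      · exact h4312 ⟨a, b, c, d, hab, hbc, hcd, h, hdb, hba⟩
      · exact h4321 ⟨a, b, c, d, hab, hbc, hcd, h, hcb, hba⟩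
    refine ⟨fun i j hij hi hj => ?_, fun i j hij hi hj => ?_, fun j hj => ?_⟩
    · by_contra hw
      have hne := w.injective.ne hij.ne
      have hcard : 2 ≤ #(crossing w (j + 1)) := two_le_card (a := i) (b := j)
        (mem_crossing.2 (by omega)) (mem_crossing.2 (by omega)) hij
      obtain ⟨c, d, hcd, hc, hc', hd'⟩ := exists_falls hcard
      exact right i j c d hij (by omega) hcd (by omega) (by omega) (by omega)
    · by_contra hw
      have hne := w.injective.ne hij.ne
      have hcard : 2 ≤ #(crossing w i) := two_le_card_crossing_of_falls (i := i) (j := j)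
        (by omega) (by omega) (by omega) (by omega) (by omega)
      obtain ⟨a, b, hab, hb, ha', hb'⟩ := exists_rises hcard
      exact left a b i j hab (by omega) hij (by omega) (by omega) (by omega)
    · by_contra hcard
      have hcard : 2 ≤ #(crossing w j) := by omega
      obtain ⟨a, b, hab, hb, ha', hb'⟩ := exists_rises hcard
      obtain ⟨c, d, hcd, hc, hc', hd'⟩ := exists_falls hcard
      have ha := w.injective.ne (show a ≠ j by omega)
      have hb := w.injective.ne (show b ≠ j by omega)
      exact left a b j d hab (by omega) (by omega) (by omega) (by omega) (by omega)

theorem IsClustered.symm {w : Equiv.Perm (Fin n)} (h : IsClustered w) :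
    IsClustered w.symm := by
  refine ⟨fun i j hij hi hj => ?_, fun i j hij hi hj => ?_, fun j hj => ?_⟩
  · have hne := w.symm.injective.ne hij.ne
    have := h.fall (w.symm j) (w.symm i)
    simp only [Equiv.apply_symm_apply] at this
    omega
  · have hne := w.symm.injective.ne hij.ne
    have := h.rise (w.symm j) (w.symm i)
    simp only [Equiv.apply_symm_apply] at this
    omega
  · rw [card_crossing_symm]
    exact h.fixed j ((Equiv.symm_apply_eq w).1 hj).symm

theorem IsHexagon.symm {w : Equiv.Perm (Fin n)} {e₁ e₂ e₃ e₄ d₁ d₂ d₃ d₄ : Fin n}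
    (h : IsHexagon w e₁ e₂ e₃ e₄ d₁ d₂ d₃ d₄) :
    IsHexagon w.symm (w d₁) (w d₂) (w d₃) (w d₄) (w e₁) (w e₂) (w e₃) (w e₄) := by
  cases h
  constructor <;> simpa

end Patterns

section Hexagon

variable {n : ℕ} {w : Equiv.Perm (Fin n)}

theorem IsClustered.hasHexagon (h : IsClustered w) {j : ℕ} (hj : 3 ≤ #(crossing w j))
    {x v : Fin n} (hx : (x : ℕ) = j ∨ (x : ℕ) = j + 1) (hv : (v : ℕ) = j ∨ (v : ℕ) = j + 1)
    (hwx : x < w x) (hwv : v < w.symm v) : HasHexagon w := by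
  obtain ⟨p₁, hp₁, p₂, hp₂, p₃, hp₃, hp₁₂, hp₂₃⟩ := exists_lt_of_three_le_card hj
  rw [← card_crossing_symm] at hj
  obtain ⟨u₁, hu₁, u₂, hu₂, u₃, hu₃, hu₁₂, hu₂₃⟩ := exists_lt_of_three_le_card hj
  rw [mem_crossing] at hp₁ hp₂ hp₃ hu₁ hu₂ hu₃
  have hp₁₂' := h.rise p₁ p₂ hp₁₂ (by omega) (by omega)
  have hu₁₂' := h.symm.rise u₁ u₂ hu₁₂ (by omega) (by omega)
  have hx' : x ≠ w.symm u₂ := by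
    rintro rfl
    rw [Equiv.apply_symm_apply] at hwx
    omega
  have hv' : v ≠ w p₂ := by
    rintro rfl
    rw [Equiv.symm_apply_apply] at hwv
    omega
  refine ⟨p₁, p₂, p₃, x, w.symm u₁, w.symm u₂, w.symm u₃, w.symm v, ?_⟩
  constructor
  · exact hp₁₂
  · exact hp₂₃
  · omega
  · exact hu₁₂'
  · exact h.symm.rise _ _ hu₂₃ (by omega) (by omega)
  · exact h.symm.rise _ _ (by omega) (by omega) hwv
  · omega
  · omega
  · exact hp₁₂'
  · exact h.rise _ _ hp₂₃ (by omega) (by omega)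
  · exact h.rise _ _ (by omega) (by omega) hwx
  all_goals
    simp only [Equiv.apply_symm_apply]
    omega

theorem four_le_card_crossing_of_falls {t : ℕ} {a b c d : Fin n} (ha : t ≤ a) (hb : t ≤ b)
    (hc : t ≤ c) (hd : t ≤ d) (hab : w a < w b) (hbc : w b < w c) (hcd : w c < w d)
    (hd' : w d < t) : 4 ≤ #(crossing w t) := by
  rw [← card_crossing_symm]
  exact four_le_card (apply_mem_crossing_symm.2 ⟨by omega, ha⟩)
    (apply_mem_crossing_symm.2 ⟨by omega, hb⟩) (apply_mem_crossing_symm.2 ⟨by omega, hc⟩)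
    (apply_mem_crossing_symm.2 ⟨hd', hd⟩) hab hbc hcd

theorem three_le_card_crossing_of_falls {t : ℕ} {a b c : Fin n} (ha : t ≤ a) (hb : t ≤ b)
    (hc : t ≤ c) (hab : w a < w b) (hbc : w b < w c) (hc' : w c < t) :
    3 ≤ #(crossing w t) := by
  rw [← card_crossing_symm]
  exact three_le_card (apply_mem_crossing_symm.2 ⟨by omega, ha⟩)
    (apply_mem_crossing_symm.2 ⟨by omega, hb⟩) (apply_mem_crossing_symm.2 ⟨hc', hc⟩) hab hbc

variable {e₁ e₂ e₃ e₄ d₁ d₂ d₃ d₄ : Fin n}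

theorem IsHexagon.three_le_card_crossing (hex : IsHexagon w e₁ e₂ e₃ e₄ d₁ d₂ d₃ d₄) :
    3 ≤ #(crossing w (max (e₃ : ℕ) (w d₃) + 1)) := by
  cases hex
  rcases le_total (w d₃ : ℕ) e₃ with h | h
  · rw [max_eq_left h]
    exact three_le_card_crossing_of_falls (a := d₁) (b := d₂) (c := d₃)
      (by omega) (by omega) (by omega) (by omega) (by omega) (by omega)
  · rw [max_eq_right h]
    exact three_le_card (a := e₁) (b := e₂) (c := e₃) (mem_crossing.2 (by omega))
      (mem_crossing.2 (by omega)) (mem_crossing.2 (by omega)) (by omega) (by omega)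

theorem IsHexagon.exists_rise (hex : IsHexagon w e₁ e₂ e₃ e₄ d₁ d₂ d₃ d₄) (h : IsClustered w)
    (hc : ∀ t, #(crossing w t) ≤ 3) :
    ∃ x : Fin n, ((x : ℕ) = max (e₃ : ℕ) (w d₃) + 1 ∨ (x : ℕ) = max (e₃ : ℕ) (w d₃) + 1 + 1) ∧
      x < w x := by
  cases hex
  obtain ⟨s, hs⟩ : ∃ s, s = max (e₃ : ℕ) (w d₃) + 1 := ⟨_, rfl⟩
  have he₄ : s ≤ e₄ := by
    by_contra he₄
    have : 4 ≤ #(crossing w s) := four_le_card (a := e₁) (b := e₂) (c := e₃) (d := e₄)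
      (mem_crossing.2 (by omega)) (mem_crossing.2 (by omega)) (mem_crossing.2 (by omega))
      (mem_crossing.2 (by omega)) (by omega) (by omega) (by omega)
    have := hc s
    omega
  have not_fixed : ∀ x : Fin n, s ≤ x → x ≤ e₄ → w x ≠ x := by
    intro x hsx hx hwx
    have := h.fixed x hwx
    have : 2 ≤ #(crossing w x) := two_le_card_crossing_of_falls (i := d₂) (j := d₃)
      (by omega) (by omega) (by omega) (by omega) (by omega)
    omega
  rw [← hs]
  by_contra! hx
  have he₄' : e₄ < w e₄ := by
    have := h.fall e₄ d₂
    have := not_fixed e₄ he₄ le_rfl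
    omega
  have hx₀ : (e₄ : ℕ) ≠ s := fun e => by
    have := hx e₄ (Or.inl e)
    omega
  have hx₁ : (e₄ : ℕ) ≠ s + 1 := fun e => by
    have := hx e₄ (Or.inr e)
    omega
  obtain ⟨x₀, hx₀⟩ : ∃ x : Fin n, (x : ℕ) = s := ⟨⟨s, by omega⟩, rfl⟩
  obtain ⟨x₁, hx₁⟩ : ∃ x : Fin n, (x : ℕ) = s + 1 := ⟨⟨s + 1, by omega⟩, rfl⟩
  have hw₀ := hx x₀ (Or.inl hx₀)
  have hw₁ := hx x₁ (Or.inr hx₁)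
  have hn₀ := not_fixed x₀ (by omega) (by omega)
  have hn₁ := not_fixed x₁ (by omega) (by omega)
  have h₀₁ := h.fall x₀ x₁ (by omega) (by omega) (by omega)
  have h₁₂ := h.fall x₁ d₂ (by omega) (by omega) (by omega)
  have : 4 ≤ #(crossing w s) := four_le_card_crossing_of_falls (a := x₀) (b := x₁) (c := d₂)
    (d := d₃) (by omega) (by omega) (by omega) (by omega) h₀₁ h₁₂ (by omega) (by omega)
  have := hc s
  omega

theorem IsClustered.not_hasHexagon (h : IsClustered w) (hc : ∀ t, #(crossing w t) ≤ 3)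
    (hw : ∀ (j : ℕ) (x v : Fin n), 3 ≤ #(crossing w j) → ((x : ℕ) = j ∨ (x : ℕ) = j + 1) →
      ((v : ℕ) = j ∨ (v : ℕ) = j + 1) → x < w x → v < w.symm v → False) :
    ¬ HasHexagon w := by
  rintro ⟨e₁, e₂, e₃, e₄, d₁, d₂, d₃, d₄, hex⟩
  obtain ⟨x, hx, hwx⟩ := hex.exists_rise h hc
  obtain ⟨v, hv, hwv⟩ := hex.symm.exists_rise h.symm (by simpa only [card_crossing_symm] using hc)
  rw [Equiv.symm_apply_apply, max_comm] at hv
  exact hw _ x v hex.three_le_card_crossing hx hv hwx hwv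

end Hexagon

section Letters

variable {n : ℕ}

/-- The letter of the index `j` of `w`. -/
def letter (w : Equiv.Perm (Fin n)) (j : Fin n) : Letter :=
  if j < w j then
    if j < w.symm j then .U else .B
  else if w j < j then
    if j < w.symm j then .A else .D
  else .F

theorem symm_apply_eq_self_iff {w : Equiv.Perm (Fin n)} {j : Fin n} : w.symm j = j ↔ w j = j := by
  rw [Equiv.symm_apply_eq, eq_comm]

theorem rises_letter {w : Equiv.Perm (Fin n)} {j : Fin n} :
    (letter w j).rises ↔ j < w j := by
  unfold letter
  split_ifs <;> simp_all [Letter.rises]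

theorem falls_letter {w : Equiv.Perm (Fin n)} {j : Fin n} :
    (letter w j).falls ↔ w j < j := by
  unfold letter
  split_ifs <;> grind [Letter.falls]

theorem opens_letter {w : Equiv.Perm (Fin n)} {j : Fin n} :
    (letter w j).opens ↔ j < w.symm j := by
  have := symm_apply_eq_self_iff (w := w) (j := j)
  unfold letter
  split_ifs <;> grind [Letter.opens]

theorem closes_letter {w : Equiv.Perm (Fin n)} {j : Fin n} :
    (letter w j).closes ↔ w.symm j < j := by
  have := symm_apply_eq_self_iff (w := w) (j := j)
  unfold letter
  split_ifs <;> grind [Letter.closes]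

theorem letter_eq_F_iff {w : Equiv.Perm (Fin n)} {j : Fin n} :
    letter w j = .F ↔ w j = j := by
  unfold letter
  split_ifs <;> simp_all <;> omega

theorem State.height_next {q : State} {a : Letter} (h : q.next a ≠ .sink) :
    (q.next a).height + (if a.closes then 1 else 0) = q.height + (if a.rises then 1 else 0) := by
  cases q <;> cases a <;> first | rfl | exact absurd rfl h

theorem State.next_ne_sink {q : State} {a : Letter} (hq : q ≠ .sink)
    (hc : a.closes → 1 ≤ q.height) (hf : a.falls → 1 ≤ q.height) (hF : a = .F → q.height ≤ 1)
    (hU : 3 ≤ q.height → a.rises → a.opens → False) (hA : q = .h3A → a.rises → False)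
    (hB : q = .h3B → a.opens → False) (hD : q = .h2D → a.rises → a.opens → False) :
    q.next a ≠ .sink := by
  cases q <;> cases a <;>
    simp_all [State.next, State.height, Letter.rises, Letter.opens, Letter.closes, Letter.falls]

theorem State.height_of_next_eq_h2D {q : State} {a : Letter} (h : q.next a = .h2D) :
    q.height = 3 := by
  cases q <;> cases a <;> first | rfl | cases h

theorem State.height_of_next_eq_h3A {q : State} {a : Letter} (h : q.next a = .h3A) :
    q.height = 3 ∧ a.opens := by
  cases q <;> cases a <;> first | exact ⟨rfl, rfl⟩ | cases h

theorem State.height_of_next_eq_h3B {q : State} {a : Letter} (h : q.next a = .h3B) :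
    q.height = 3 ∧ a.rises := by
  cases q <;> cases a <;> first | exact ⟨rfl, rfl⟩ | cases h

theorem IsClustered.run_letter_invariant {w : Equiv.Perm (Fin n)} (h : IsClustered w)
    (hex : ¬ HasHexagon w) {t : ℕ} (ht : t ≤ n) (q : State)
    (hq : State.run .h0 ((List.ofFn (letter w)).take t) = q) :
    q ≠ .sink ∧ q.height = #(crossing w t) ∧
      (q = .h2D → ∃ s : Fin n, (s : ℕ) + 1 = t ∧ 3 ≤ #(crossing w s)) ∧
      (q = .h3A → ∃ s : Fin n, (s : ℕ) + 1 = t ∧ 3 ≤ #(crossing w s) ∧ s < w.symm s) ∧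
      (q = .h3B → ∃ s : Fin n, (s : ℕ) + 1 = t ∧ 3 ≤ #(crossing w s) ∧ s < w s) := by
  induction t generalizing q with
  | zero =>
    subst hq
    simp [State.run, State.height, crossing_zero]
  | succ t ih =>
    obtain ⟨r, hr⟩ : ∃ r, State.run .h0 ((List.ofFn (letter w)).take t) = r := ⟨_, rfl⟩
    obtain ⟨hr₁, hr₂, hr₃, hr₄, hr₅⟩ := ih (by omega) r hr
    obtain ⟨j, rfl⟩ : ∃ j : Fin n, (j : ℕ) = t := ⟨⟨t, by omega⟩, rfl⟩
    rw [State.run_take_succ, hr] at hq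
    subst hq
    have hcard := card_crossing_succ w j
    simp only [← rises_letter, ← closes_letter] at hcard
    have hcloses : (letter w j).closes → 1 ≤ #(crossing w j) := fun hj => by
      rw [closes_letter] at hj
      exact card_pos.2 ⟨w.symm j, mem_crossing.2 (by simpa using hj)⟩
    have hfalls : (letter w j).falls → 1 ≤ #(crossing w j) := fun hj => by
      rw [falls_letter] at hj
      rw [← card_crossing_symm]
      exact card_pos.2 ⟨w j, mem_crossing.2 (by simpa using hj)⟩
    have hF : letter w j = .F → #(crossing w j) ≤ 1 := fun hj => h.fixed j (letter_eq_F_iff.1 hj)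
    have hU : ∀ s : ℕ, (j : ℕ) = s ∨ (j : ℕ) = s + 1 → 3 ≤ #(crossing w s) →
        (letter w j).rises → (letter w j).opens → False := fun s hs hs₃ h₁ h₂ =>
      hex (h.hasHexagon hs₃ hs hs (rises_letter.1 h₁) (opens_letter.1 h₂))
    have hA : r = .h3A → (letter w j).rises → False := fun e h₁ => by
      obtain ⟨s, hs, hs₃, hs'⟩ := hr₄ e
      exact hex (h.hasHexagon hs₃ (Or.inr hs.symm) (Or.inl rfl) (rises_letter.1 h₁) hs')
    have hB : r = .h3B → (letter w j).opens → False := fun e h₁ => by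
      obtain ⟨s, hs, hs₃, hs'⟩ := hr₅ e
      exact hex (h.hasHexagon hs₃ (Or.inl rfl) (Or.inr hs.symm) hs' (opens_letter.1 h₁))
    have hD : r = .h2D → (letter w j).rises → (letter w j).opens → False := fun e h₁ h₂ => by
      obtain ⟨s, hs, hs₃⟩ := hr₃ e
      exact hU s (Or.inr hs.symm) hs₃ h₁ h₂
    have hne : r.next (letter w j) ≠ .sink := by
      rw [← hr₂] at hcloses hfalls hF
      exact State.next_ne_sink hr₁ hcloses hfalls hF (fun h₃ => hU j (Or.inl rfl) (hr₂ ▸ h₃))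
        hA hB hD
    refine ⟨hne, ?_, fun e => ?_, fun e => ?_, fun e => ?_⟩
    · have := State.height_next hne
      omega
    · have := State.height_of_next_eq_h2D e
      exact ⟨j, rfl, by omega⟩
    · have := State.height_of_next_eq_h3A e
      exact ⟨j, rfl, by omega, opens_letter.1 this.2⟩
    · have := State.height_of_next_eq_h3B e
      exact ⟨j, rfl, by omega, rises_letter.1 this.2⟩

theorem IsClustered.run_letter {w : Equiv.Perm (Fin n)} (h : IsClustered w)
    (hex : ¬ HasHexagon w) : State.run .h0 (List.ofFn (letter w)) = .h0 := by
  obtain ⟨q, hq⟩ : ∃ q, State.run .h0 (List.ofFn (letter w)) = q := ⟨_, rfl⟩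
  obtain ⟨h₁, h₂, -⟩ := h.run_letter_invariant hex le_rfl q
    (by rwa [List.take_of_length_le (by simp)])
  rw [hq]
  rw [crossing_self, card_empty] at h₂
  cases q <;> simp_all [State.height]

theorem IsClustered.eq_of_letter_eq {w w' : Equiv.Perm (Fin n)} (h : IsClustered w)
    (h' : IsClustered w') (hl : letter w = letter w') : w = w' := by
  have key : ∀ {w w' : Equiv.Perm (Fin n)}, IsClustered w' → letter w = letter w' →
      ∀ i, (∀ k < i, w k = w' k) → w' i ≤ w i := by
    intro w w' h' hl i ih
    by_contra! hi
    obtain ⟨k, hk⟩ := w'.surjective (w i)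
    have hki : i < k := by
      rcases lt_trichotomy k i with hlt | rfl | hlt
      · exact absurd (w.injective ((ih k hlt).trans hk)) hlt.ne
      · exact absurd hk hi.ne'
      · exact hlt
    have h₁ : i < w i ↔ i < w' i := by rw [← rises_letter, hl, rises_letter]
    have h₂ : w i < i ↔ w' i < i := by rw [← falls_letter, hl, falls_letter]
    have h₃ : i < w i ↔ k < w i := by
      have : w.symm (w i) < w i ↔ w'.symm (w i) < w i := by
        rw [← closes_letter, hl, closes_letter]
      rwa [Equiv.symm_apply_apply, ← hk, Equiv.symm_apply_apply, hk] at this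
    have h₅ := h'.rise i k hki
    have h₆ := h'.fall i k hki
    rw [hk] at h₅ h₆
    omega
  refine Equiv.ext fun i => ?_
  induction i using WellFoundedLT.induction with
  | ind i ih => exact (key h hl.symm i fun k hk => (ih k hk).symm).antisymm (key h' hl i ih)

end Letters

section Words

variable {n : ℕ} {v : Fin n → Letter}

theorem card_filter_lt_succ (P : Fin n → Bool) (t : Fin n) :
    #{j | P j ∧ (j : ℕ) < t + 1} = #{j | P j ∧ (j : ℕ) < t} + if P t then 1 else 0 := by
  have : (({j | P j ∧ (j : ℕ) < t + 1} : Finset (Fin n))) =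
      ({j | P j ∧ (j : ℕ) < t} : Finset (Fin n)) ∪ if P t then {t} else ∅ := by
    ext j
    by_cases h : P t <;> simp [h] <;> grind
  rw [this, card_union_of_disjoint]
  · split_ifs <;> rfl
  · split_ifs <;> simp

/-- In a word leading from `h0` to `h0`, the letters raising the height can be matched with the
letters lowering it, in increasing order, so that every letter is matched with a later one. -/
theorem exists_orderIso_of_run (p m : Letter → Bool)
    (h : ∀ q a, State.next q a ≠ .sink →
      (q.next a).height + (if m a then 1 else 0) = q.height + if p a then 1 else 0)
    (hm : ∀ q a, State.next q a ≠ .sink → (if m a then 1 else 0) ≤ q.height)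
    (hv : State.run .h0 (List.ofFn v) = .h0) :
    ∃ e : {j // p (v j)} ≃o {j // m (v j)}, ∀ i, i.1 < (e i).1 := by
  have hne : ∀ t : Fin n,
      (State.run .h0 ((List.ofFn v).take t)).next (v t) ≠ .sink := fun t => by
    rw [← State.run_take_succ]
    exact State.run_take_ne_sink hv _
  have hcard : ∀ t : ℕ, t ≤ n → (State.run .h0 ((List.ofFn v).take t)).height +
      #{j | m (v j) ∧ (j : ℕ) < t} = #{j | p (v j) ∧ (j : ℕ) < t} := by
    intro t ht
    induction t with
    | zero => simp [State.run, State.height]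
    | succ t ih =>
      obtain ⟨j, rfl⟩ : ∃ j : Fin n, (j : ℕ) = t := ⟨⟨t, by omega⟩, rfl⟩
      have := h _ _ (hne j)
      rw [card_filter_lt_succ (fun j => m (v j)), card_filter_lt_succ (fun j => p (v j)),
        State.run_take_succ]
      have := ih j.2.le
      omega
  have heq : Fintype.card {j // p (v j)} = Fintype.card {j // m (v j)} := by
    have := hcard n le_rfl
    rw [List.take_of_length_le (by simp), hv] at this
    simpa [State.height, Fintype.card_subtype] using this.symm
  obtain ⟨e⟩ : Nonempty ({j // p (v j)} ≃o {j // m (v j)}) :=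
    ⟨(Fintype.orderIsoFinOfCardEq _ heq).symm.trans (Fintype.orderIsoFinOfCardEq _ rfl)⟩
  refine ⟨e, fun i => ?_⟩
  by_contra! hi
  have h₁ := hcard i i.1.2.le
  have h₂ := hm _ _ (hne i)
  have h₃ := card_filter_lt_succ (fun j => m (v j)) i
  have h₄ := card_filter_lt_succ (fun j => p (v j)) i
  have h₅ : #{j | p (v j) ∧ (j : ℕ) < i + 1} ≤ #{j | m (v j) ∧ (j : ℕ) < i + 1} := by
    refine card_le_card_of_injOn (fun j => if hj : p (v j) then (e ⟨j, hj⟩ : Fin n) else j) ?_ ?_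
    · intro j hj
      simp only [coe_filter, mem_univ, true_and, Set.mem_ofPred_eq] at hj ⊢
      have hle : e ⟨j, hj.1⟩ ≤ e i := e.monotone (show j ≤ i from Nat.lt_succ_iff.1 hj.2)
      rw [dif_pos hj.1]
      exact ⟨(e ⟨j, hj.1⟩).2, Nat.lt_succ_iff.2 (le_trans hle hi)⟩
    · intro j hj k hk hjk
      simp only [coe_filter, mem_univ, true_and, Set.mem_ofPred_eq] at hj hk
      simp only [dif_pos hj.1, dif_pos hk.1] at hjk
      exact congrArg Subtype.val (e.injective (Subtype.ext hjk))
  have h₆ := i.2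
  simp only [h₆, if_true] at h₄
  omega

theorem exists_letter_eq (hv : State.run .h0 (List.ofFn v) = .h0) :
    ∃ w : Equiv.Perm (Fin n), letter w = v ∧
      (∀ i j, i < j → i < w i → j < w j → w i < w j) ∧
      ∀ i j, i < j → w i < i → w j < j → w i < w j := by
  obtain ⟨e, he⟩ := exists_orderIso_of_run Letter.rises Letter.closes
    (fun _ _ => State.height_next)
    (fun q a => by cases q <;> cases a <;> decide) hv
  obtain ⟨e', he'⟩ := exists_orderIso_of_run Letter.opens Letter.falls
    (fun q a => by cases q <;> cases a <;> decide)
    (fun q a => by cases q <;> cases a <;> decide) hv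
  have hrf : ∀ {a : Letter}, a.rises → ¬ a.falls := by decide
  have hco : ∀ {a : Letter}, a.opens → ¬ a.closes := by decide
  have hF : ∀ {a : Letter}, ¬ a.rises → ¬ a.falls → ¬ a.closes ∧ ¬ a.opens := by decide
  have hF' : ∀ {a : Letter}, ¬ a.closes → ¬ a.opens → ¬ a.rises ∧ ¬ a.falls := by decide
  let w : Equiv.Perm (Fin n) :=
    { toFun j := if h : (v j).rises then e ⟨j, h⟩ else
        if h : (v j).falls then e'.symm ⟨j, h⟩ else j
      invFun j := if h : (v j).closes then e.symm ⟨j, h⟩ else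
        if h : (v j).opens then e' ⟨j, h⟩ else j
      left_inv j := by
        by_cases h₁ : (v j).rises
        · have := (e ⟨j, h₁⟩).2
          simp [h₁, this]
        · by_cases h₂ : (v j).falls
          · have := (e'.symm ⟨j, h₂⟩).2
            simp [h₁, h₂, this, hco this]
          · simp [h₁, h₂, hF h₁ h₂]
      right_inv j := by
        by_cases h₁ : (v j).closes
        · have := (e.symm ⟨j, h₁⟩).2
          simp [h₁, this]
        · by_cases h₂ : (v j).opens
          · have := (e' ⟨j, h₂⟩).2
            have h₃ : ¬ (v (e' ⟨j, h₂⟩)).rises := fun h => hrf h this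
            simp [h₁, h₂, this, h₃]
          · simp [h₁, h₂, hF' h₁ h₂] }
  have hw : ∀ j (h : (v j).rises), w j = e ⟨j, h⟩ := fun j h => dif_pos h
  have hw' : ∀ j (h : (v j).falls), w j = e'.symm ⟨j, h⟩ := fun j h =>
    (dif_neg fun h' => hrf h' h).trans (dif_pos h)
  have hs : ∀ j (h : (v j).closes), w.symm j = e.symm ⟨j, h⟩ := fun j h => dif_pos h
  have hs' : ∀ j (h : (v j).opens), w.symm j = e' ⟨j, h⟩ := fun j h =>
    (dif_neg (hco h)).trans (dif_pos h)
  have hrises : ∀ j, (v j).rises → j < w j := fun j h => (he ⟨j, h⟩).trans_eq (hw j h).symm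
  have hfalls : ∀ j, (v j).falls → w j < j := fun j h => by
    simpa [← hw' j h] using he' (e'.symm ⟨j, h⟩)
  have hcloses : ∀ j, (v j).closes → w.symm j < j := fun j h => by
    simpa [← hs j h] using he (e.symm ⟨j, h⟩)
  have hopens : ∀ j, (v j).opens → j < w.symm j := fun j h => (he' ⟨j, h⟩).trans_eq (hs' j h).symm
  have hfixed : ∀ j, v j = .F → w j = j := fun j h =>
    (dif_neg (by simp [h, Letter.rises])).trans (dif_neg (by simp [h, Letter.falls]))
  have hletter : letter w = v := by
    funext j
    have h₁ := hrises j
    have h₂ := hfalls j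
    have h₃ := hcloses j
    have h₄ := hopens j
    have h₅ := hfixed j
    unfold letter
    cases hj : v j <;> rw [hj] at h₁ h₂ h₃ h₄ h₅ <;>
      grind [Letter.rises, Letter.falls, Letter.opens, Letter.closes]
  refine ⟨w, hletter, fun i j hij hi hj => ?_, fun i j hij hi hj => ?_⟩
  · rw [← rises_letter, hletter] at hi hj
    rw [hw i hi, hw j hj]
    exact e.strictMono (show (⟨i, hi⟩ : {j // (v j).rises}) < ⟨j, hj⟩ from hij)
  · rw [← falls_letter, hletter] at hi hj
    rw [hw' i hi, hw' j hj]
    exact e'.symm.strictMono (show (⟨i, hi⟩ : {j // (v j).falls}) < ⟨j, hj⟩ from hij)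

variable {w : Equiv.Perm (Fin n)}

theorem next_letter_ne_sink (hw : State.run .h0 (List.ofFn (letter w)) = .h0) (t : Fin n) :
    (State.run .h0 ((List.ofFn (letter w)).take t)).next (letter w t) ≠ .sink := by
  rw [← State.run_take_succ]
  exact State.run_take_ne_sink hw _

theorem height_run_letter (hw : State.run .h0 (List.ofFn (letter w)) = .h0) {t : ℕ}
    (ht : t ≤ n) :
    (State.run .h0 ((List.ofFn (letter w)).take t)).height = #(crossing w t) := by
  induction t with
  | zero => simp [State.run, State.height, crossing_zero]
  | succ t ih =>
    obtain ⟨j, rfl⟩ : ∃ j : Fin n, (j : ℕ) = t := ⟨⟨t, by omega⟩, rfl⟩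
    have h₁ := State.height_next (next_letter_ne_sink hw j)
    have h₂ := card_crossing_succ w j
    have h₃ := ih j.2.le
    simp only [← rises_letter, ← closes_letter] at h₂
    rw [State.run_take_succ]
    omega

theorem State.height_le_three (q : State) : q.height ≤ 3 := by
  cases q <;> decide

theorem State.height_le_one {q : State} (h : q.next .F ≠ .sink) : q.height ≤ 1 := by
  cases q <;> first | decide | exact absurd rfl h

theorem State.not_rises_and_opens {q : State} {a : Letter} (hq : 3 ≤ q.height)
    (ha : q.next a ≠ .sink) : ¬ (a.rises ∧ a.opens) := by
  cases q <;> cases a <;> first | decide | exact absurd hq (by decide) | exact absurd rfl ha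

theorem State.not_rises_and_opens_of_next {q : State} {a b : Letter} (hq : 3 ≤ q.height)
    (ha : q.next a ≠ .sink) (hb : (q.next a).next b ≠ .sink) :
    ¬ (a.rises ∧ b.opens) ∧ ¬ (b.rises ∧ a.opens) ∧ ¬ (b.rises ∧ b.opens) := by
  cases q <;> cases a <;> first
    | exact absurd hq (by decide)
    | exact absurd rfl ha
    | cases b <;> first | decide | exact absurd rfl hb

theorem card_crossing_le_three (hw : State.run .h0 (List.ofFn (letter w)) = .h0) (t : ℕ) :
    #(crossing w t) ≤ 3 := by
  rcases le_or_gt t n with ht | ht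
  · rw [← height_run_letter hw ht]
    exact State.height_le_three _
  · rw [card_eq_zero.2]
    · omega
    · ext i
      simp only [mem_crossing, notMem_empty, iff_false]
      omega

theorem isClustered_of_run (hw : State.run .h0 (List.ofFn (letter w)) = .h0)
    (hr : ∀ i j, i < j → i < w i → j < w j → w i < w j)
    (hf : ∀ i j, i < j → w i < i → w j < j → w i < w j) : IsClustered w where
  rise := hr
  fall := hf
  fixed j hj := by
    rw [← height_run_letter hw j.2.le]
    have := next_letter_ne_sink hw j
    rw [letter_eq_F_iff.2 hj] at this
    exact State.height_le_one this

theorem IsClustered.not_hasHexagon_of_run (h : IsClustered w)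
    (hw : State.run .h0 (List.ofFn (letter w)) = .h0) : ¬ HasHexagon w := by
  refine h.not_hasHexagon (card_crossing_le_three hw) fun j x y hj hx hy hxw hyw => ?_
  have hjn : j < n := by
    obtain ⟨i, hi⟩ := card_pos.1 (show 0 < #(crossing w j) by omega)
    rw [mem_crossing] at hi
    omega
  obtain ⟨j, rfl⟩ : ∃ k : Fin n, (k : ℕ) = j := ⟨⟨j, hjn⟩, rfl⟩
  rw [← rises_letter] at hxw
  rw [← opens_letter] at hyw
  rw [← height_run_letter hw j.2.le] at hj
  have hne := next_letter_ne_sink hw j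
  have key : ∀ k : Fin n, (k : ℕ) = j + 1 → _ := fun k hk => by
    have := next_letter_ne_sink hw k
    rw [hk, State.run_take_succ] at this
    exact State.not_rises_and_opens_of_next hj hne this
  rcases hx with hx | hx <;> rcases hy with hy | hy
  · obtain rfl := Fin.ext hx
    obtain rfl := Fin.ext hy
    exact State.not_rises_and_opens hj hne ⟨hxw, hyw⟩
  · obtain rfl := Fin.ext hx
    exact (key y hy).1 ⟨hxw, hyw⟩
  · obtain rfl := Fin.ext hy
    exact (key x hx).2.1 ⟨hxw, hyw⟩
  · obtain rfl : x = y := Fin.ext (hx.trans hy.symm)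
    exact (key x hx).2.2 ⟨hxw, hyw⟩

end Words

theorem card_avoiding (n : ℕ) :
    Nat.card {w : Equiv.Perm (Fin n) //
      AvoidsPattern w p3421 ∧ AvoidsPattern w p4312 ∧ AvoidsPattern w p4321 ∧
      AvoidsPattern w p46718235 ∧ AvoidsPattern w p46781235 ∧
      AvoidsPattern w p56718234 ∧ AvoidsPattern w p56781234} = State.count n .h0 := by
  have key : ∀ w : Equiv.Perm (Fin n),
      (AvoidsPattern w p3421 ∧ AvoidsPattern w p4312 ∧ AvoidsPattern w p4321 ∧
        AvoidsPattern w p46718235 ∧ AvoidsPattern w p46781235 ∧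
        AvoidsPattern w p56718234 ∧ AvoidsPattern w p56781234) ↔
      IsClustered w ∧ ¬ HasHexagon w := fun w => by
    rw [isClustered_iff, hasHexagon_iff]
    simp only [AvoidsPattern, not_or, and_assoc]
  rw [State.count, ← Nat.card_eq_fintype_card]
  refine Nat.card_congr (Equiv.ofBijective
    (fun w => ⟨letter w.1, ((key w).1 w.2).1.run_letter ((key w).1 w.2).2⟩) ⟨?_, ?_⟩)
  · intro w w' hww'
    exact Subtype.ext
      (((key w).1 w.2).1.eq_of_letter_eq ((key w').1 w'.2).1 (congrArg Subtype.val hww'))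
  · rintro ⟨v, hv⟩
    obtain ⟨w, rfl, hr, hf⟩ := exists_letter_eq hv
    have hw := isClustered_of_run hv hr hf
    exact ⟨⟨w, (key w).2 ⟨hw, hw.not_hasHexagon_of_run hv⟩⟩, rfl⟩

end ClusteredHexagon

/-- The number `m n` of maximally-clustered hexagon-avoiding permutations in `S_n` (avoiding
3421, 4312, 4321, 46718235, 46781235, 56718234, 56781234) satisfies
`m (n+1) = 7 m n - 15 m (n-1) + 14 m (n-2) - 8 m (n-3) - 4 m (n-4) + 3 m (n-5)` for `n ≥ 9`,
with initial values `m 3 = 6, …, m 10 = 70644`. -/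
theorem stmt_18
    (m : ℕ → ℕ)
    (hm : ∀ n, m n = Nat.card {w : Equiv.Perm (Fin n) //
      AvoidsPattern w p3421 ∧ AvoidsPattern w p4312 ∧ AvoidsPattern w p4321 ∧
      AvoidsPattern w p46718235 ∧ AvoidsPattern w p46781235 ∧
      AvoidsPattern w p56718234 ∧ AvoidsPattern w p56781234}) :
    (∀ n, 9 ≤ n → (m (n + 1) : ℤ) =
      7 * m n - 15 * m (n - 1) + 14 * m (n - 2) - 8 * m (n - 3) - 4 * m (n - 4)
        + 3 * m (n - 5)) ∧
    m 3 = 6 ∧ m 4 = 21 ∧ m 5 = 78 ∧ m 6 = 298 ∧ m 7 = 1157 ∧ m 8 = 4535 ∧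
    m 9 = 17872 ∧ m 10 = 70644 := by
  obtain rfl : m = fun n => ClusteredHexagon.State.count n .h0 :=
    funext fun n => (hm n).trans (ClusteredHexagon.card_avoiding n)
  refine ⟨fun n hn => ?_, ClusteredHexagon.State.count_h0_values⟩
  obtain ⟨k, rfl⟩ := Nat.exists_eq_add_of_le' (show 5 ≤ n by omega)
  exact ClusteredHexagon.State.count_recurrence k
end
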